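/- arXiv:2305.14265 — 4 statements merged into one kernel-verified Lean document; each statement's English description precedes it below -/
import Mathlib

section
/- In the bivariate Gaussian model, for every B ∈ [0, ∞], the minimax risk inf_δ sup_{θ ∈ ℝ, |b| ≤ B} R(θ, b, δ) equals ρ²·Σ_U·r^BNM(B/√Σ_O) + (1 − ρ²)·Σ_U, and this minimax risk is attained by the estimator δ*(Y_U, T_O) = ρ·√Σ_U·δ^BNM(T_O; B/√Σ_O) + Y_U − ρ·√Σ_U·T_O, where δ^BNM(·; τ) is any measurable function attaining the bounded normal mean minimax risk r^BNM(τ) with τ = B/√Σ_O. -/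
open MeasureTheory ProbabilityTheory
open scoped ENNReal

/-- Gaussian shift risk: `r(δ, μ) = E_{T ~ N(μ,1)}[(δ(T) − μ)²]`, valued in `[0,∞]`. -/
noncomputable def gShiftRisk (δ : ℝ → ℝ) (μ : ℝ) : ℝ≥0∞ :=
  ∫⁻ t, ENNReal.ofReal ((δ t - μ) ^ 2) ∂(gaussianReal μ 1)

/-- Bounded normal mean minimax risk with (possibly infinite) bound `τ ∈ [0,∞]`:
the infimum over measurable `δ : ℝ → ℝ` of the supremum of `r(δ, μ)` over `|μ| ≤ τ`. -/
noncomputable def rBNMe (τ : ℝ≥0∞) : ℝ≥0∞ :=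
  ⨅ δ : {f : ℝ → ℝ // Measurable f},
    ⨆ μ : {μ : ℝ // ENNReal.ofReal |μ| ≤ τ}, gShiftRisk δ μ

/-- Squared-error risk for estimating `θ` in the bivariate Gaussian model: one observes
`(Y_U, T_O)` jointly normal with mean `(θ, b/√Σ_U)` and covariance
`[[Σ_U, ρ√Σ_U], [ρ√Σ_U, 1]]` (here `sU = Σ_U`, `sO = Σ_O`), constructed from two
independent standard normals. -/
noncomputable def bivRisk (sU sO ρ θ b : ℝ) (δ : ℝ × ℝ → ℝ) : ℝ≥0∞ :=
  ∫⁻ z : ℝ × ℝ,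
    ENNReal.ofReal ((δ (θ + Real.sqrt sU * (ρ * z.2 + Real.sqrt (1 - ρ ^ 2) * z.1),
      b / Real.sqrt sO + z.2) - θ) ^ 2)
    ∂((gaussianReal 0 1).prod (gaussianReal 0 1))

/-- The second moment of an affine function of a standard normal variable. -/
lemma lintegral_sq_add_mul_gaussianReal (a c : ℝ) :
    ∫⁻ z, ENNReal.ofReal ((a + c * z) ^ 2) ∂(gaussianReal 0 1)
      = ENNReal.ofReal (a ^ 2) + ENNReal.ofReal (c ^ 2) := by
  have hid : MemLp (fun z : ℝ => z) 2 (gaussianReal 0 1) :=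
    memLp_id_gaussianReal' 2 (by simp)
  have hlin : Integrable (fun z : ℝ => z) (gaussianReal 0 1) := hid.integrable one_le_two
  have hsq : Integrable (fun z : ℝ => z ^ 2) (gaussianReal 0 1) := hid.integrable_sq
  have hmean : ∫ z, z ∂(gaussianReal 0 1) = 0 := integral_id_gaussianReal
  have hmom : ∫ z, z ^ 2 ∂(gaussianReal 0 1) = 1 := by
    have h := variance_eq_sub hid
    rw [variance_fun_id_gaussianReal] at h
    simpa [hmean] using h.symm
  have hexp : (fun z : ℝ => (a + c * z) ^ 2)
      = fun z => (a ^ 2 + 2 * a * c * z) + c ^ 2 * z ^ 2 := by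
    funext z; ring
  have hint₁ : Integrable (fun z : ℝ => a ^ 2 + 2 * a * c * z) (gaussianReal 0 1) :=
    (integrable_const _).add (hlin.const_mul _)
  have hint : Integrable (fun z : ℝ => (a + c * z) ^ 2) (gaussianReal 0 1) := by
    rw [hexp]; exact hint₁.add (hsq.const_mul _)
  rw [← ofReal_integral_eq_lintegral_ofReal hint (ae_of_all _ fun z => sq_nonneg _),
    ← ENNReal.ofReal_add (sq_nonneg a) (sq_nonneg c), hexp,
    integral_add hint₁ (hsq.const_mul _),
    integral_add (integrable_const _) (hlin.const_mul _), integral_const_mul,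
    integral_const_mul, hmean, hmom]
  simp

/-- Jensen's inequality for the squared distance to a constant; it needs no integrability, because
the right-hand side is infinite when `f` is not square-integrable. -/
lemma ofReal_sq_integral_sub_le_lintegral {Ω : Type*} [MeasurableSpace Ω] (P : Measure Ω)
    [IsProbabilityMeasure P] {f : Ω → ℝ} (hf : Measurable f) (a : ℝ) :
    ENNReal.ofReal ((∫ x, f x ∂P - a) ^ 2) ≤ ∫⁻ x, ENNReal.ofReal ((f x - a) ^ 2) ∂P := by
  by_cases htop : ∫⁻ x, ENNReal.ofReal ((f x - a) ^ 2) ∂P = ⊤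
  · simp [htop]
  have hsub : Measurable fun x => f x - a := hf.sub_const a
  have hsq : Integrable (fun x => (f x - a) ^ 2) P :=
    ⟨(hsub.pow_const 2).aestronglyMeasurable,
      (hasFiniteIntegral_iff_ofReal (ae_of_all _ fun x => sq_nonneg _)).2
        (lt_top_iff_ne_top.2 htop)⟩
  have hL2 : MemLp (fun x => f x - a) 2 P :=
    (memLp_two_iff_integrable_sq hsub.aestronglyMeasurable).2 hsq
  have hfint : Integrable f P :=
    ((hL2.integrable one_le_two).add (integrable_const a)).congr (ae_of_all _ fun x => by simp)
  have hmean : ∫ x, (f x - a) ∂P = ∫ x, f x ∂P - a := by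
    rw [integral_sub hfint (integrable_const a)]; simp
  rw [← ofReal_integral_eq_lintegral_ofReal hsq (ae_of_all _ fun x => sq_nonneg _)]
  refine ENNReal.ofReal_le_ofReal ?_
  have hvar := variance_nonneg (fun x => f x - a) P
  rw [variance_eq_sub hL2, hmean] at hvar
  simpa using hvar

/-- The Gaussian shift risk as an integral against the standard normal law. -/
lemma gShiftRisk_eq_lintegral {δ : ℝ → ℝ} (hδ : Measurable δ) (μ : ℝ) :
    gShiftRisk δ μ = ∫⁻ z, ENNReal.ofReal ((δ (μ + z) - μ) ^ 2) ∂(gaussianReal 0 1) := by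
  have hmap : (gaussianReal 0 1).map (μ + ·) = gaussianReal μ 1 := by
    rw [gaussianReal_map_const_add, zero_add]
  rw [gShiftRisk, ← hmap, lintegral_map (by fun_prop) (by fun_prop)]

/-- Conditioning on the second coordinate in the bivariate risk. -/
lemma bivRisk_eq_lintegral_lintegral (sU sO ρ θ b : ℝ) {δ : ℝ × ℝ → ℝ} (hδ : Measurable δ) :
    bivRisk sU sO ρ θ b δ = ∫⁻ t, ∫⁻ z,
      ENNReal.ofReal ((δ (θ + Real.sqrt sU * (ρ * t + Real.sqrt (1 - ρ ^ 2) * z),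
        b / Real.sqrt sO + t) - θ) ^ 2) ∂(gaussianReal 0 1) ∂(gaussianReal 0 1) := by
  rw [bivRisk, lintegral_prod_symm' _ (by fun_prop)]

/-- The risk of the estimator built from an estimator `d` of the standardized bias. -/
lemma bivRisk_debiased {sU sO ρ : ℝ} (hsU : 0 < sU) (hρ : ρ ∈ Set.Ioo (-1 : ℝ) 1)
    {d : ℝ → ℝ} (hd : Measurable d) (θ b : ℝ) :
    bivRisk sU sO ρ θ b
        (fun p => ρ * Real.sqrt sU * d p.2 + p.1 - ρ * Real.sqrt sU * p.2)
      = ENNReal.ofReal (ρ ^ 2 * sU) * gShiftRisk d (b / Real.sqrt sO)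
        + ENNReal.ofReal ((1 - ρ ^ 2) * sU) := by
  have hs : Real.sqrt sU ^ 2 = sU := Real.sq_sqrt hsU.le
  have hr : Real.sqrt (1 - ρ ^ 2) ^ 2 = 1 - ρ ^ 2 :=
    Real.sq_sqrt (by nlinarith [hρ.1, hρ.2])
  rw [bivRisk_eq_lintegral_lintegral _ _ _ _ _ (by fun_prop), gShiftRisk_eq_lintegral hd,
    ← lintegral_const_mul _ (by fun_prop)]
  set m := b / Real.sqrt sO
  have hinner : ∀ t : ℝ, ∫⁻ z, ENNReal.ofReal ((ρ * Real.sqrt sU * d (m + t)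
        + (θ + Real.sqrt sU * (ρ * t + Real.sqrt (1 - ρ ^ 2) * z))
        - ρ * Real.sqrt sU * (m + t) - θ) ^ 2) ∂(gaussianReal 0 1)
      = ENNReal.ofReal (ρ ^ 2 * sU) * ENNReal.ofReal ((d (m + t) - m) ^ 2)
        + ENNReal.ofReal ((1 - ρ ^ 2) * sU) := by
    intro t
    rw [← ENNReal.ofReal_mul (by positivity)]
    convert lintegral_sq_add_mul_gaussianReal (ρ * Real.sqrt sU * (d (m + t) - m))
      (Real.sqrt sU * Real.sqrt (1 - ρ ^ 2)) using 3
    · congr 1; ring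
    · rw [mul_pow, mul_pow, hs]
    · rw [mul_pow, hs, hr, mul_comm]
  simp only [hinner]
  rw [lintegral_add_right _ measurable_const]
  simp

/-- Bayes risk for a normal location observed with independent normal noise of scale `c`, where the
prior has scale `c * (cos α / sin α)`: the posterior variance is `(c * cos α) ^ 2`, and the
remaining term is bounded below by Jensen's inequality. -/
lemma le_lintegral_lintegral_normal_prior {c α : ℝ} (hα : Real.sin α ≠ 0)
    {h : ℝ → ℝ} (hh : Measurable h) (a : ℝ) :
    ENNReal.ofReal ((∫ p, (h (c / Real.sin α * p) - Real.cos α ^ 2 * (c / Real.sin α * p))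
          ∂(gaussianReal 0 1) - a) ^ 2) + ENNReal.ofReal ((c * Real.cos α) ^ 2)
      ≤ ∫⁻ u, ∫⁻ z, ENNReal.ofReal ((h (c * (Real.cos α / Real.sin α) * u + c * z)
          - (c * (Real.cos α / Real.sin α) * u + a)) ^ 2)
            ∂(gaussianReal 0 1) ∂(gaussianReal 0 1) := by
  set f : ℝ → ℝ := fun p => h (c / Real.sin α * p) - Real.cos α ^ 2 * (c / Real.sin α * p)
    with hf_def
  have hf : Measurable f := by fun_prop
  have hrot : ((gaussianReal 0 1).prod (gaussianReal 0 1)).map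
      (ContinuousLinearMap.rotation α) = (gaussianReal 0 1).prod (gaussianReal 0 1) :=
    IsGaussian.map_rotation_eq_self (by simp) α
  calc ENNReal.ofReal ((∫ p, f p ∂(gaussianReal 0 1) - a) ^ 2)
        + ENNReal.ofReal ((c * Real.cos α) ^ 2)
      ≤ ∫⁻ p, ENNReal.ofReal ((f p - a) ^ 2) ∂(gaussianReal 0 1)
        + ENNReal.ofReal ((c * Real.cos α) ^ 2) := by
        gcongr
        exact ofReal_sq_integral_sub_le_lintegral _ hf a
    _ = ∫⁻ p, ∫⁻ q, ENNReal.ofReal ((f p - a + c * Real.cos α * q) ^ 2)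
          ∂(gaussianReal 0 1) ∂(gaussianReal 0 1) := by
        simp only [lintegral_sq_add_mul_gaussianReal]
        rw [lintegral_add_right _ measurable_const]
        simp
    _ = ∫⁻ w, ENNReal.ofReal ((f w.1 - a + c * Real.cos α * w.2) ^ 2)
          ∂((gaussianReal 0 1).prod (gaussianReal 0 1)) := by
        rw [lintegral_prod _ (by fun_prop)]
    _ = ∫⁻ w : ℝ × ℝ, ENNReal.ofReal ((h (c * (Real.cos α / Real.sin α) * w.1 + c * w.2)
          - (c * (Real.cos α / Real.sin α) * w.1 + a)) ^ 2)
          ∂((gaussianReal 0 1).prod (gaussianReal 0 1)) := by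
        conv_lhs => rw [← hrot]
        rw [lintegral_map (by fun_prop) (by fun_prop)]
        refine lintegral_congr fun w => ?_
        simp only [ContinuousLinearMap.rotation_apply, smul_eq_mul, hf_def]
        have hobs : c / Real.sin α * (Real.cos α * w.1 + Real.sin α * w.2)
            = c * (Real.cos α / Real.sin α) * w.1 + c * w.2 := by
          field_simp
        rw [hobs]
        congr 2
        field_simp
        linear_combination (-(c * Real.cos α * w.1)) * Real.sin_sq_add_cos_sq α
    _ = _ := by
        rw [lintegral_prod _ (by fun_prop)]

/-- Averaging over normal priors on `θ` bounds the worst-case bivariate risk of any estimator below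
by the bounded normal mean risk plus a fraction `cos α ^ 2` of the residual variance. -/
lemma le_iSup_bivRisk_of_sin_ne_zero {sU sO ρ : ℝ} (hsU : 0 < sU)
    (hρ : ρ ∈ Set.Ioo (-1 : ℝ) 1) (hρ0 : ρ ≠ 0) {δ : ℝ × ℝ → ℝ} (hδ : Measurable δ)
    {ι : Type*} (b : ι → ℝ) {α : ℝ} (hα : Real.sin α ≠ 0) :
    ∃ d : ℝ → ℝ, Measurable d ∧ ∀ i,
      ENNReal.ofReal (ρ ^ 2 * sU) * gShiftRisk d (b i / Real.sqrt sO)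
        + ENNReal.ofReal ((1 - ρ ^ 2) * sU * Real.cos α ^ 2)
      ≤ ⨆ θ : ℝ, bivRisk sU sO ρ θ (b i) δ := by
  have hs : Real.sqrt sU ^ 2 = sU := Real.sq_sqrt hsU.le
  have hs0 : Real.sqrt sU ≠ 0 := (Real.sqrt_pos.2 hsU).ne'
  have hr : Real.sqrt (1 - ρ ^ 2) ^ 2 = 1 - ρ ^ 2 :=
    Real.sq_sqrt (by nlinarith [hρ.1, hρ.2])
  set k : ℝ := ρ * Real.sqrt sU with hk
  have hk0 : k ≠ 0 := mul_ne_zero hρ0 hs0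
  have hk2 : k ^ 2 = ρ ^ 2 * sU := by rw [hk, mul_pow, hs]
  set c : ℝ := Real.sqrt sU * Real.sqrt (1 - ρ ^ 2) with hc
  have hc2 : c ^ 2 = (1 - ρ ^ 2) * sU := by rw [hc, mul_pow, hs, hr, mul_comm]
  set e : ℝ → ℝ := fun t => ∫ p, (δ (c / Real.sin α * p + k * t, t)
    - Real.cos α ^ 2 * (c / Real.sin α * p)) ∂(gaussianReal 0 1) with he_def
  have he : Measurable e := by
    have hjoint : Measurable fun w : ℝ × ℝ => δ (c / Real.sin α * w.2 + k * w.1, w.1)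
        - Real.cos α ^ 2 * (c / Real.sin α * w.2) := by fun_prop
    exact hjoint.stronglyMeasurable.integral_prod_right.measurable
  refine ⟨fun t => e t / k, he.div_const k, fun i => ?_⟩
  set m := b i / Real.sqrt sO with hm
  set η : ℝ → ℝ := fun u => c * (Real.cos α / Real.sin α) * u with hη
  calc ENNReal.ofReal (ρ ^ 2 * sU) * gShiftRisk (fun t => e t / k) m
        + ENNReal.ofReal ((1 - ρ ^ 2) * sU * Real.cos α ^ 2)
      = ∫⁻ t, (ENNReal.ofReal ((e (m + t) - k * m) ^ 2)
          + ENNReal.ofReal ((c * Real.cos α) ^ 2)) ∂(gaussianReal 0 1) := by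
        rw [gShiftRisk_eq_lintegral (he.div_const k), ← lintegral_const_mul _ (by fun_prop),
          lintegral_add_right _ measurable_const, lintegral_const, measure_univ, mul_one,
          mul_pow, hc2]
        congr 1
        refine lintegral_congr fun t => ?_
        rw [← hk2, ← ENNReal.ofReal_mul (sq_nonneg k), ← mul_pow]
        congr 2
        field_simp
    _ ≤ ∫⁻ t, ∫⁻ u, ∫⁻ z, ENNReal.ofReal ((δ (η u + c * z + k * (m + t), m + t)
          - (η u + k * m)) ^ 2)
          ∂(gaussianReal 0 1) ∂(gaussianReal 0 1) ∂(gaussianReal 0 1) :=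
        lintegral_mono fun t => le_lintegral_lintegral_normal_prior hα
          (h := fun x => δ (x + k * (m + t), m + t)) (by fun_prop) (k * m)
    _ = ∫⁻ u, ∫⁻ t, ∫⁻ z, ENNReal.ofReal ((δ (η u + c * z + k * (m + t), m + t)
          - (η u + k * m)) ^ 2)
          ∂(gaussianReal 0 1) ∂(gaussianReal 0 1) ∂(gaussianReal 0 1) := by
        refine lintegral_lintegral_swap (Measurable.aemeasurable ?_)
        have hη' : Measurable η := by fun_prop
        have hjoint : Measurable fun w : (ℝ × ℝ) × ℝ =>
            ENNReal.ofReal ((δ (η w.1.2 + c * w.2 + k * (m + w.1.1), m + w.1.1)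
              - (η w.1.2 + k * m)) ^ 2) := by fun_prop
        exact hjoint.lintegral_prod_right'
    _ = ∫⁻ u, bivRisk sU sO ρ (η u + k * m) (b i) δ ∂(gaussianReal 0 1) := by
        refine lintegral_congr fun u => ?_
        rw [bivRisk_eq_lintegral_lintegral _ _ _ _ _ hδ]
        refine lintegral_congr fun t => lintegral_congr fun z => ?_
        have harg : η u + c * z + k * (m + t) = η u + k * m
            + Real.sqrt sU * (ρ * t + Real.sqrt (1 - ρ ^ 2) * z) := by
          rw [hc, hk]; ring
        rw [harg]
    _ ≤ ∫⁻ _u, (⨆ θ : ℝ, bivRisk sU sO ρ θ (b i) δ) ∂(gaussianReal 0 1) :=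
        lintegral_mono fun u => le_iSup (fun θ => bivRisk sU sO ρ θ (b i) δ) (η u + k * m)
    _ = ⨆ θ : ℝ, bivRisk sU sO ρ θ (b i) δ := by simp

/-- Rescaling the bias by `√sO` identifies the two parameter sets. -/
lemma ofReal_abs_div_sqrt_le_iff {sO : ℝ} (hsO : 0 < sO) (b : ℝ) (B : ℝ≥0∞) :
    ENNReal.ofReal |b / Real.sqrt sO| ≤ B / ENNReal.ofReal (Real.sqrt sO)
      ↔ ENNReal.ofReal |b| ≤ B := by
  have hs : 0 < Real.sqrt sO := Real.sqrt_pos.2 hsO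
  rw [abs_div, abs_of_pos hs, ENNReal.ofReal_div_of_pos hs]
  have hs0 : ENNReal.ofReal (Real.sqrt sO) ≠ 0 := (ENNReal.ofReal_pos.2 hs).ne'
  rw [ENNReal.le_div_iff_mul_le (.inl hs0) (.inl ENNReal.ofReal_ne_top),
    ENNReal.div_mul_cancel hs0 ENNReal.ofReal_ne_top]

/-- The worst-case shift risk, reindexed by the unstandardized bias. -/
lemma iSup_gShiftRisk_div_sqrt {sO : ℝ} (hsO : 0 < sO) (B : ℝ≥0∞) (d : ℝ → ℝ) :
    ⨆ b : {b : ℝ // ENNReal.ofReal |b| ≤ B}, gShiftRisk d (b / Real.sqrt sO)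
      = ⨆ μ : {μ : ℝ // ENNReal.ofReal |μ| ≤ B / ENNReal.ofReal (Real.sqrt sO)},
          gShiftRisk d μ := by
  have hs : Real.sqrt sO ≠ 0 := (Real.sqrt_pos.2 hsO).ne'
  refine le_antisymm (iSup_le fun b => ?_) (iSup_le fun μ => ?_)
  · exact le_iSup (fun μ : {μ : ℝ // ENNReal.ofReal |μ| ≤ B / ENNReal.ofReal (Real.sqrt sO)} =>
      gShiftRisk d μ) ⟨b / Real.sqrt sO, (ofReal_abs_div_sqrt_le_iff hsO b B).2 b.2⟩
  · have hμ : (μ : ℝ) * Real.sqrt sO / Real.sqrt sO = μ := mul_div_cancel_right₀ _ hs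
    have hb : ENNReal.ofReal |(μ : ℝ) * Real.sqrt sO| ≤ B :=
      (ofReal_abs_div_sqrt_le_iff hsO _ B).1 (by rw [hμ]; exact μ.2)
    refine le_iSup_of_le ⟨μ * Real.sqrt sO, hb⟩ ?_
    rw [hμ]

/-- The minimax lower bound: the worst-case risk of every estimator is at least
`ρ ^ 2 * sU * rBNMe (B / √sO) + (1 - ρ ^ 2) * sU`. -/
lemma rBNMe_le_iSup_bivRisk {sU sO ρ : ℝ} (hsU : 0 < sU) (hsO : 0 < sO)
    (hρ : ρ ∈ Set.Ioo (-1 : ℝ) 1) (hρ0 : ρ ≠ 0) (B : ℝ≥0∞)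
    {δ : ℝ × ℝ → ℝ} (hδ : Measurable δ) :
    ENNReal.ofReal (ρ ^ 2 * sU) * rBNMe (B / ENNReal.ofReal (Real.sqrt sO))
        + ENNReal.ofReal ((1 - ρ ^ 2) * sU)
      ≤ ⨆ θ : ℝ, ⨆ b : {b : ℝ // ENNReal.ofReal |b| ≤ B}, bivRisk sU sO ρ θ b δ := by
  have : Nonempty {b : ℝ // ENNReal.ofReal |b| ≤ B} := ⟨⟨0, by simp⟩⟩
  have hlim : Filter.Tendsto (fun α : ℝ =>
      ENNReal.ofReal (ρ ^ 2 * sU) * rBNMe (B / ENNReal.ofReal (Real.sqrt sO))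
        + ENNReal.ofReal ((1 - ρ ^ 2) * sU * Real.cos α ^ 2))
      (nhdsWithin 0 (Set.Ioi 0))
      (nhds (ENNReal.ofReal (ρ ^ 2 * sU) * rBNMe (B / ENNReal.ofReal (Real.sqrt sO))
        + ENNReal.ofReal ((1 - ρ ^ 2) * sU))) := by
    have hcos : Continuous fun α : ℝ => ENNReal.ofReal ((1 - ρ ^ 2) * sU * Real.cos α ^ 2) :=
      ENNReal.continuous_ofReal.comp (by fun_prop)
    have hcos0 := (hcos.tendsto 0).mono_left (nhdsWithin_le_nhds (s := Set.Ioi 0))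
    simp only [Real.cos_zero, one_pow, mul_one] at hcos0
    exact tendsto_const_nhds.add hcos0
  refine le_of_tendsto hlim ?_
  filter_upwards [Ioo_mem_nhdsGT Real.pi_pos] with α hα
  obtain ⟨d, hd, hle⟩ := le_iSup_bivRisk_of_sin_ne_zero (sO := sO) hsU hρ hρ0 hδ
    (fun b : {b : ℝ // ENNReal.ofReal |b| ≤ B} => (b : ℝ))
    (Real.sin_pos_of_mem_Ioo hα).ne'
  have hr : rBNMe (B / ENNReal.ofReal (Real.sqrt sO))
      ≤ ⨆ b : {b : ℝ // ENNReal.ofReal |b| ≤ B}, gShiftRisk d (b / Real.sqrt sO) := by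
    rw [iSup_gShiftRisk_div_sqrt hsO]
    exact iInf_le (fun f : {f : ℝ → ℝ // Measurable f} =>
      ⨆ μ : {μ : ℝ // ENNReal.ofReal |μ| ≤ B / ENNReal.ofReal (Real.sqrt sO)},
        gShiftRisk f μ) ⟨d, hd⟩
  rw [iSup_comm]
  refine (add_le_add_left (mul_le_mul_right hr _) _).trans ?_
  rw [ENNReal.mul_iSup, ENNReal.iSup_add]
  exact iSup_mono hle

/-- **B-minimax risk and estimator in the bivariate Gaussian model.**
For every `B ∈ [0, ∞]`, the minimax risk `inf_δ sup_{θ ∈ ℝ, |b| ≤ B} R(θ, b, δ)` equals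
`ρ²·Σ_U·r^BNM(B/√Σ_O) + (1 − ρ²)·Σ_U`, and is attained by
`δ*(Y_U, T_O) = ρ·√Σ_U·δ^BNM(T_O) + Y_U − ρ·√Σ_U·T_O`, where `δ^BNM` is any measurable
function attaining the bounded normal mean minimax risk with bound `τ = B/√Σ_O`. -/
theorem stmt_1 (sU sO ρ : ℝ) (hsU : 0 < sU) (hsO : 0 < sO)
    (hρ : ρ ∈ Set.Ioo (-1 : ℝ) 1) (hρ0 : ρ ≠ 0)
    (B : ℝ≥0∞)
    (δBNM : ℝ → ℝ) (hmeas : Measurable δBNM)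
    (hopt : (⨆ μ : {μ : ℝ // ENNReal.ofReal |μ| ≤ B / ENNReal.ofReal (Real.sqrt sO)},
        gShiftRisk δBNM μ) = rBNMe (B / ENNReal.ofReal (Real.sqrt sO))) :
    (⨅ δ : {f : ℝ × ℝ → ℝ // Measurable f},
        ⨆ θ : ℝ, ⨆ b : {b : ℝ // ENNReal.ofReal |b| ≤ B}, bivRisk sU sO ρ θ b δ)
      = ENNReal.ofReal (ρ ^ 2 * sU) * rBNMe (B / ENNReal.ofReal (Real.sqrt sO))
        + ENNReal.ofReal ((1 - ρ ^ 2) * sU) ∧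
    (⨆ θ : ℝ, ⨆ b : {b : ℝ // ENNReal.ofReal |b| ≤ B},
        bivRisk sU sO ρ θ b
          (fun p => ρ * Real.sqrt sU * δBNM p.2 + p.1 - ρ * Real.sqrt sU * p.2))
      = ENNReal.ofReal (ρ ^ 2 * sU) * rBNMe (B / ENNReal.ofReal (Real.sqrt sO))
        + ENNReal.ofReal ((1 - ρ ^ 2) * sU) := by
  have : Nonempty {b : ℝ // ENNReal.ofReal |b| ≤ B} := ⟨⟨0, by simp⟩⟩
  have hattain : (⨆ θ : ℝ, ⨆ b : {b : ℝ // ENNReal.ofReal |b| ≤ B},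
        bivRisk sU sO ρ θ b
          (fun p => ρ * Real.sqrt sU * δBNM p.2 + p.1 - ρ * Real.sqrt sU * p.2))
      = ENNReal.ofReal (ρ ^ 2 * sU) * rBNMe (B / ENNReal.ofReal (Real.sqrt sO))
        + ENNReal.ofReal ((1 - ρ ^ 2) * sU) := by
    simp only [bivRisk_debiased hsU hρ hmeas]
    rw [iSup_const, ← ENNReal.iSup_add, ← ENNReal.mul_iSup, iSup_gShiftRisk_div_sqrt hsO, hopt]
  refine ⟨le_antisymm ?_ (le_iInf fun δ => rBNMe_le_iSup_bivRisk hsU hsO hρ hρ0 B δ.2), hattain⟩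
  rw [← hattain]
  exact iInf_le (fun δ : {f : ℝ × ℝ → ℝ // Measurable f} =>
    ⨆ θ : ℝ, ⨆ b : {b : ℝ // ENNReal.ofReal |b| ≤ B}, bivRisk sU sO ρ θ b δ)
    ⟨_, by fun_prop⟩
end

section
/- In the bivariate Gaussian model, suppose the measurable function δ̃: ℝ → ℝ minimizes, over all measurable functions, the adaptation objective A(δ̃, ρ) = sup_{b̃ ∈ ℝ} (r(δ̃, b̃) + ρ^{−2} − 1)/(r^BNM(|b̃|) + ρ^{−2} − 1). Then the estimator δ^adapt(Y_U, T_O) = ρ·√Σ_U·δ̃(T_O) + Y_U − ρ·√Σ_U·T_O minimizes, over all estimators δ: ℝ² → ℝ, the worst-case adaptation regret sup_{B ∈ [0, ∞]} [sup_{θ ∈ ℝ, |b| ≤ B} R(θ, b, δ)] / R*(B), where R*(B) = inf_δ sup_{θ ∈ ℝ, |b| ≤ B} R(θ, b, δ). -/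
open MeasureTheory ProbabilityTheory
open scoped ENNReal

/-- Bounded normal mean minimax risk for a real bound `τ ≥ 0`:
`r^BNM(τ) = inf_{δ measurable} sup_{μ ∈ [−τ, τ]} r(δ, μ)`. -/
noncomputable def rBNM (τ : ℝ) : ℝ≥0∞ :=
  ⨅ δ : {f : ℝ → ℝ // Measurable f}, ⨆ μ ∈ Set.Icc (-τ) τ, gShiftRisk δ μ

/-- Worst-case risk over `θ ∈ ℝ` and biases `|b| ≤ B`, for `B ∈ [0,∞]`. -/
noncomputable def bivRmax (sU sO ρ : ℝ) (B : ℝ≥0∞) (δ : ℝ × ℝ → ℝ) : ℝ≥0∞ :=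
  ⨆ θ : ℝ, ⨆ b : {b : ℝ // ENNReal.ofReal |b| ≤ B}, bivRisk sU sO ρ θ b δ

/-- `B`-minimax risk `R*(B)` over measurable estimators. -/
noncomputable def bivRstar (sU sO ρ : ℝ) (B : ℝ≥0∞) : ℝ≥0∞ :=
  ⨅ δ : {f : ℝ × ℝ → ℝ // Measurable f}, bivRmax sU sO ρ B δ

/-- Worst-case adaptation regret `sup_{B ∈ [0,∞]} R_max(B, δ) / R*(B)`. -/
noncomputable def bivRegret (sU sO ρ : ℝ) (δ : ℝ × ℝ → ℝ) : ℝ≥0∞ :=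
  ⨆ B : ℝ≥0∞, bivRmax sU sO ρ B δ / bivRstar sU sO ρ B

/-- The adaptation objective
`A(δ̃, ρ) = sup_{b̃ ∈ ℝ} (r(δ̃, b̃) + ρ⁻² − 1)/(r^BNM(|b̃|) + ρ⁻² − 1)`. -/
noncomputable def adaptObj (ρ : ℝ) (δ : ℝ → ℝ) : ℝ≥0∞ :=
  ⨆ b : ℝ, (gShiftRisk δ b + ENNReal.ofReal ((ρ ^ 2)⁻¹ - 1)) /
    (rBNM |b| + ENNReal.ofReal ((ρ ^ 2)⁻¹ - 1))

open Filter Topology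

/-- Nested nonempty bounded closed convex subsets of a Hilbert space have a common point. -/
lemma nonempty_iInter_of_antitone_convex {H : Type*} [NormedAddCommGroup H]
    [InnerProductSpace ℝ H] [CompleteSpace H] {K : ℕ → Set H} (hanti : Antitone K)
    (hne : ∀ n, (K n).Nonempty) (hcl : ∀ n, IsClosed (K n)) (hconv : ∀ n, Convex ℝ (K n))
    {D : ℝ} (hbdd : ∀ x ∈ K 0, ‖x‖ ≤ D) : (⋂ n, K n).Nonempty := by
  choose p hpK hp using fun n =>
    exists_norm_eq_iInf_of_complete_convex (hne n) (hcl n).isComplete (hconv n) 0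
  have hinner (n : ℕ) : ∀ w ∈ K n, inner ℝ (0 - p n) (w - p n) ≤ 0 :=
    (norm_eq_iInf_iff_real_inner_le_zero (hconv n) (hpK n)).1 (hp n)
  have hdist {n m : ℕ} (hnm : n ≤ m) : ‖p m - p n‖ ^ 2 ≤ ‖p m‖ ^ 2 - ‖p n‖ ^ 2 := by
    have h := hinner n (p m) (hanti hnm (hpK m))
    have h2 : ‖p m‖ ^ 2 = ‖p n + (p m - p n)‖ ^ 2 := by congr 2; abel
    rw [norm_add_sq_real] at h2
    rw [zero_sub, inner_neg_left] at h
    linarith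
  have hmono : Monotone fun n => ‖p n‖ ^ 2 := fun n m hnm => by
    have := hdist hnm
    have := sq_nonneg ‖p m - p n‖
    simp only
    linarith
  have hbound : BddAbove (Set.range fun n => ‖p n‖ ^ 2) := by
    refine ⟨D ^ 2, ?_⟩
    rintro _ ⟨n, rfl⟩
    have := hbdd (p n) (hanti (Nat.zero_le n) (hpK n))
    simp only
    gcongr
  have hcau := (tendsto_atTop_ciSup hmono hbound).cauchySeq
  have hpcau : CauchySeq p := by
    rw [Metric.cauchySeq_iff'] at hcau ⊢
    intro ε hε
    obtain ⟨N, hN⟩ := hcau (ε ^ 2) (by positivity)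
    refine ⟨N, fun n hn => ?_⟩
    have h1 := hN n hn
    rw [Real.dist_eq] at h1
    rw [dist_eq_norm]
    have h2 := hdist hn
    have h3 := le_abs_self (‖p n‖ ^ 2 - ‖p N‖ ^ 2)
    exact lt_of_pow_lt_pow_left₀ 2 hε.le (by linarith)
  obtain ⟨q, hq⟩ := cauchySeq_tendsto_of_complete hpcau
  refine ⟨q, Set.mem_iInter.2 fun n => ?_⟩
  exact (hcl n).mem_of_tendsto hq
    (eventually_atTop.2 ⟨n, fun m hm => hanti hm (hpK m)⟩)

lemma lintegral_ofReal_affine_sq_gaussianReal (p q : ℝ) :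
    ∫⁻ z, ENNReal.ofReal ((p * z + q) ^ 2) ∂(gaussianReal 0 1) = ENNReal.ofReal (p ^ 2 + q ^ 2) := by
  have hmem : MemLp (fun z : ℝ => z) 2 (gaussianReal 0 1) :=
    memLp_id_gaussianReal' 2 (by simp)
  have hint : Integrable (fun z : ℝ => z) (gaussianReal 0 1) := hmem.integrable (by norm_num)
  have hint2 : Integrable (fun z : ℝ => z ^ 2) (gaussianReal 0 1) := hmem.integrable_sq
  have hsq : ∫ z, z ^ 2 ∂(gaussianReal 0 1) = 1 := by
    have h := variance_fun_id_gaussianReal (μ := 0) (v := 1)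
    rw [variance_eq_integral (by fun_prop)] at h
    simpa using h
  have hexp : (fun z : ℝ => (p * z + q) ^ 2) =
      fun z => p ^ 2 * z ^ 2 + (2 * p * q * z + q ^ 2) := by
    ext z; ring
  have hi1 : Integrable (fun z : ℝ => 2 * p * q * z + q ^ 2) (gaussianReal 0 1) :=
    (hint.const_mul _).add (integrable_const _)
  rw [← ofReal_integral_eq_lintegral_ofReal]
  · rw [hexp, integral_add (hint2.const_mul _) hi1,
      integral_add (hint.const_mul _) (integrable_const _), integral_const_mul,
      integral_const_mul, hsq, integral_id_gaussianReal]
    simp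
  · rw [hexp]
    exact (hint2.const_mul _).add hi1
  · exact ae_of_all _ fun z => sq_nonneg _

/-- Jensen's inequality for the square, valid without integrability assumptions. -/
lemma ofReal_sq_integral_le_lintegral {Ω : Type*} [MeasurableSpace Ω] (μ : Measure Ω)
    [IsProbabilityMeasure μ] {f : Ω → ℝ} (hf : Measurable f) :
    ENNReal.ofReal ((∫ x, f x ∂μ) ^ 2) ≤ ∫⁻ x, ENNReal.ofReal (f x ^ 2) ∂μ := by
  by_cases hfin : ∫⁻ x, ENNReal.ofReal (f x ^ 2) ∂μ = ∞
  · simp [hfin]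
  have hint2 : Integrable (fun x => f x ^ 2) μ := by
    refine ⟨(hf.pow_const 2).aestronglyMeasurable, ?_⟩
    rw [hasFiniteIntegral_iff_ofReal (ae_of_all _ fun x => sq_nonneg _)]
    exact lt_top_iff_ne_top.2 hfin
  have hmem : MemLp f 2 μ := (memLp_two_iff_integrable_sq hf.aestronglyMeasurable).2 hint2
  rw [← ofReal_integral_eq_lintegral_ofReal hint2 (ae_of_all _ fun x => sq_nonneg _)]
  refine ENNReal.ofReal_le_ofReal ?_
  have h := variance_nonneg f μ
  rw [variance_eq_sub hmem] at h
  simpa using h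

/-- Jensen's inequality after adding a square-integrable centred perturbation. -/
lemma ofReal_sq_integral_sub_le_lintegral_s2 {Ω : Type*} [MeasurableSpace Ω] (μ : Measure Ω)
    [IsProbabilityMeasure μ] {e h : Ω → ℝ} (he : Measurable e) (hei : Integrable e μ)
    (he0 : ∫ x, e x ∂μ = 0) (hh : Measurable h) {p : ℝ} (hp : p ≠ 0) (c : ℝ) :
    ENNReal.ofReal ((p * ((∫ x, h x ∂μ) - c)) ^ 2)
      ≤ ∫⁻ x, ENNReal.ofReal ((e x + p * (h x - c)) ^ 2) ∂μ := by
  have hmeas : Measurable fun x => e x + p * (h x - c) := by fun_prop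
  by_cases hfin : ∫⁻ x, ENNReal.ofReal ((e x + p * (h x - c)) ^ 2) ∂μ = ∞
  · simp [hfin]
  have hint2 : Integrable (fun x => (e x + p * (h x - c)) ^ 2) μ := by
    refine ⟨(hmeas.pow_const 2).aestronglyMeasurable, ?_⟩
    rw [hasFiniteIntegral_iff_ofReal (ae_of_all _ fun x => sq_nonneg _)]
    exact lt_top_iff_ne_top.2 hfin
  have hint : Integrable (fun x => e x + p * (h x - c)) μ :=
    ((memLp_two_iff_integrable_sq hmeas.aestronglyMeasurable).2 hint2).integrable (by norm_num)
  have hhi : Integrable h μ := by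
    have h1 := ((hint.sub hei).const_mul p⁻¹).add (integrable_const c)
    refine h1.congr (ae_of_all _ fun x => ?_)
    simp only [Pi.add_apply, Pi.sub_apply]
    field_simp
    ring
  have hhc : Integrable (fun x => h x - c) μ := hhi.sub (integrable_const c)
  have hval : ∫ x, (e x + p * (h x - c)) ∂μ = p * ((∫ x, h x ∂μ) - c) := by
    rw [integral_add hei (hhc.const_mul p), integral_const_mul,
      integral_sub hhi (integrable_const c), he0]
    simp
  rw [← hval]
  exact ofReal_sq_integral_le_lintegral μ hmeas

lemma lintegral_rotation_gaussianReal (α : ℝ) {F : ℝ × ℝ → ℝ≥0∞} (hF : Measurable F) :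
    ∫⁻ x, F (Real.cos α * x.1 + Real.sin α * x.2, -Real.sin α * x.1 + Real.cos α * x.2)
        ∂((gaussianReal 0 1).prod (gaussianReal 0 1)) =
      ∫⁻ x, F x ∂((gaussianReal 0 1).prod (gaussianReal 0 1)) := by
  have h := IsGaussian.map_rotation_eq_self (μ := gaussianReal 0 1)
    (by simp [integral_id_gaussianReal]) α
  conv_rhs => rw [← h]
  rw [lintegral_map hF (by fun_prop)]
  simp [ContinuousLinearMap.rotation_apply]

/-- Bayes risk bound for estimating the location `φ` of `X ~ N(φ, m²)` up to the offset `p * c`,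
under a centred Gaussian prior on `φ` with standard deviation `m * cos α / sin α`. -/
lemma gaussian_bayes_bound {m p α : ℝ} (hp : p ≠ 0) (hα : Real.sin α ≠ 0) (c : ℝ)
    {f : ℝ → ℝ} (hf : Measurable f) :
    ENNReal.ofReal ((m * Real.cos α) ^ 2) + ENNReal.ofReal (p ^ 2) * ENNReal.ofReal
        (((∫ x, (f (m / Real.sin α * x) - m / Real.sin α * x) / p ∂(gaussianReal 0 1)) - c) ^ 2)
      ≤ ∫⁻ x : ℝ × ℝ, ENNReal.ofReal ((f (m * Real.cos α / Real.sin α * x.1 + m * x.2)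
          - (p * c + m * Real.cos α / Real.sin α * x.1)) ^ 2)
          ∂((gaussianReal 0 1).prod (gaussianReal 0 1)) := by
  set h : ℝ → ℝ := fun x => (f (m / Real.sin α * x) - m / Real.sin α * x) / p with hh
  have hhm : Measurable h := by fun_prop
  let F : ℝ × ℝ → ℝ≥0∞ := fun y => ENNReal.ofReal
    ((m * Real.cos α * y.2 + (m * Real.sin α * y.1 + p * (h y.1 - c))) ^ 2)
  have hF : Measurable F := by fun_prop
  have hrot : ∫⁻ x : ℝ × ℝ, ENNReal.ofReal ((f (m * Real.cos α / Real.sin α * x.1 + m * x.2)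
          - (p * c + m * Real.cos α / Real.sin α * x.1)) ^ 2)
          ∂((gaussianReal 0 1).prod (gaussianReal 0 1)) =
      ∫⁻ y, F y ∂((gaussianReal 0 1).prod (gaussianReal 0 1)) := by
    rw [← lintegral_rotation_gaussianReal α hF]
    refine lintegral_congr fun x => ?_
    have harg : m / Real.sin α * (Real.cos α * x.1 + Real.sin α * x.2) =
        m * Real.cos α / Real.sin α * x.1 + m * x.2 := by
      field_simp
    have hph (y : ℝ) : p * (h y - c) = f (m / Real.sin α * y) - m / Real.sin α * y - p * c := by
      simp only [hh]
      field_simp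
    simp only [F]
    rw [hph, harg]
    congr 2
    linear_combination (-(m * x.2)) * Real.sin_sq_add_cos_sq α
  rw [hrot, lintegral_prod _ hF.aemeasurable]
  simp only [F]
  simp_rw [lintegral_ofReal_affine_sq_gaussianReal, ENNReal.ofReal_add (sq_nonneg _) (sq_nonneg _)]
  rw [lintegral_add_left measurable_const, lintegral_const, measure_univ, mul_one,
    ← ENNReal.ofReal_mul (sq_nonneg _), ← mul_pow]
  gcongr
  have hid : Integrable (fun x : ℝ => x) (gaussianReal 0 1) :=
    (memLp_id_gaussianReal' (μ := 0) (v := 1) 2 (by simp)).integrable (by norm_num)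
  refine ofReal_sq_integral_sub_le_lintegral_s2 _ (by fun_prop) (hid.const_mul _) ?_ hhm hp c
  rw [integral_const_mul, integral_id_gaussianReal, mul_zero]

lemma gShiftRisk_eq_lintegral_standard {g : ℝ → ℝ} (hg : Measurable g) (c : ℝ) :
    gShiftRisk g c = ∫⁻ z, ENNReal.ofReal ((g (c + z) - c) ^ 2) ∂(gaussianReal 0 1) := by
  have h : gaussianReal c 1 = (gaussianReal 0 1).map (fun z => c + z) := by
    rw [gaussianReal_map_const_add, zero_add]
  rw [gShiftRisk, h, lintegral_map (by fun_prop) (by fun_prop)]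

lemma gShiftRisk_congr {f g : ℝ → ℝ} (h : f =ᵐ[volume] g) (c : ℝ) :
    gShiftRisk f c = gShiftRisk g c := by
  refine lintegral_congr_ae ?_
  filter_upwards [(gaussianReal_absolutelyContinuous c one_ne_zero).ae_le h] with t ht
  rw [ht]

lemma eLpNorm_sub_const_sq (g : ℝ → ℝ) (c : ℝ) :
    eLpNorm (fun t => g t - c) 2 (gaussianReal c 1) ^ (2 : ℝ) = gShiftRisk g c := by
  have h := eLpNorm_nnreal_pow_eq_lintegral (f := fun t => g t - c) (μ := gaussianReal c 1)
    (p := 2) two_ne_zero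
  rw [show ((2 : NNReal) : ℝ≥0∞) = 2 by simp, show ((2 : NNReal) : ℝ) = 2 by simp] at h
  rw [h, gShiftRisk]
  refine lintegral_congr fun t => ?_
  rw [Real.enorm_eq_ofReal_abs, ENNReal.ofReal_rpow_of_nonneg (abs_nonneg _) (by norm_num)]
  simp

lemma gShiftRisk_convex_comb {f g : ℝ → ℝ} (hf : Measurable f) {s t : ℝ} (hs : 0 ≤ s)
    (ht : 0 ≤ t) (hst : s + t = 1) (c : ℝ) {N : ℝ≥0∞} (hfN : gShiftRisk f c ≤ N)
    (hgN : gShiftRisk g c ≤ N) : gShiftRisk (fun x => s * f x + t * g x) c ≤ N := by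
  calc gShiftRisk (fun x => s * f x + t * g x) c
      ≤ ∫⁻ x, (ENNReal.ofReal s * ENNReal.ofReal ((f x - c) ^ 2) +
          ENNReal.ofReal t * ENNReal.ofReal ((g x - c) ^ 2)) ∂(gaussianReal c 1) := by
        refine lintegral_mono fun x => ?_
        rw [← ENNReal.ofReal_mul hs, ← ENNReal.ofReal_mul ht,
          ← ENNReal.ofReal_add (by positivity) (by positivity)]
        refine ENNReal.ofReal_le_ofReal ?_
        obtain rfl : t = 1 - s := by linarith
        nlinarith [mul_nonneg (mul_nonneg hs ht) (sq_nonneg (f x - g x))]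
    _ = ENNReal.ofReal s * gShiftRisk f c + ENNReal.ofReal t * gShiftRisk g c := by
        rw [lintegral_add_left (by fun_prop), lintegral_const_mul' _ _ ENNReal.ofReal_ne_top,
          lintegral_const_mul' _ _ ENNReal.ofReal_ne_top, gShiftRisk, gShiftRisk]
    _ ≤ ENNReal.ofReal s * N + ENNReal.ofReal t * N := by gcongr
    _ = N := by rw [← add_mul, ← ENNReal.ofReal_add hs ht, hst, ENNReal.ofReal_one, one_mul]

/-- Lower semicontinuity of the shift risk along almost everywhere convergent sequences. -/
lemma gShiftRisk_le_of_tendsto_ae {f : ℕ → ℝ → ℝ} {g : ℝ → ℝ} (hf : ∀ n, Measurable (f n))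
    (hfg : ∀ᵐ x, Tendsto (fun n => f n x) atTop (𝓝 (g x))) (c : ℝ) {N : ℝ≥0∞}
    (hN : ∀ n, gShiftRisk (f n) c ≤ N) : gShiftRisk g c ≤ N := by
  calc gShiftRisk g c
      = ∫⁻ x, liminf (fun n => ENNReal.ofReal ((f n x - c) ^ 2)) atTop ∂(gaussianReal c 1) := by
        refine lintegral_congr_ae ?_
        filter_upwards [(gaussianReal_absolutelyContinuous c one_ne_zero).ae_le hfg] with x hx
        refine (Tendsto.liminf_eq ?_).symm
        exact (ENNReal.continuous_ofReal.tendsto _).comp ((hx.sub_const c).pow 2)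
    _ ≤ liminf (fun n => gShiftRisk (f n) c) atTop :=
        lintegral_liminf_le fun n => by have := hf n; fun_prop
    _ ≤ N := by
        refine liminf_le_of_le (by isBoundedDefault) fun b hb => ?_
        obtain ⟨n, hn⟩ := hb.exists
        exact hn.trans (hN n)

/-- Compactness of the set of shift-risk functions: decreasing bounds that can each be met by a
measurable estimator can be met simultaneously. -/
lemma exists_forall_gShiftRisk_le {N : ℕ → ℝ → ℝ≥0∞} (hanti : Antitone N)
    (hex : ∀ n, ∃ g : ℝ → ℝ, Measurable g ∧ ∀ c, gShiftRisk g c ≤ N n c)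
    {c₀ : ℝ} (hfin : N 0 c₀ ≠ ∞) :
    ∃ g : ℝ → ℝ, Measurable g ∧ ∀ n c, gShiftRisk g c ≤ N n c := by
  have hac : volume ≪ gaussianReal c₀ 1 := gaussianReal_absolutelyContinuous' c₀ one_ne_zero
  let K : ℕ → Set (Lp ℝ 2 (gaussianReal c₀ 1)) := fun n => {g | ∀ c, gShiftRisk g c ≤ N n c}
  have hmeas (g : Lp ℝ 2 (gaussianReal c₀ 1)) : Measurable g := (Lp.stronglyMeasurable g).measurable
  have hsub {g : ℝ → ℝ} (hg : gShiftRisk g c₀ ≤ N 0 c₀) :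
      eLpNorm (fun t => g t - c₀) 2 (gaussianReal c₀ 1) ≤ N 0 c₀ ^ (1 / 2 : ℝ) := by
    rw [← eLpNorm_sub_const_sq] at hg
    rwa [one_div, ENNReal.le_rpow_inv_iff two_pos]
  have hDfin : N 0 c₀ ^ (1 / 2 : ℝ) ≠ ∞ := ENNReal.rpow_ne_top_of_nonneg (by norm_num) hfin
  have hne (n : ℕ) : (K n).Nonempty := by
    obtain ⟨g, hg, hgN⟩ := hex n
    have hmem : MemLp g 2 (gaussianReal c₀ 1) := by
      have h1 : MemLp (fun t => g t - c₀) 2 (gaussianReal c₀ 1) :=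
        ⟨by fun_prop, (hsub ((hgN c₀).trans (hanti (Nat.zero_le n) c₀))).trans_lt
          (lt_top_iff_ne_top.2 hDfin)⟩
      have h2 := h1.add (memLp_const c₀)
      rwa [show ((fun t => g t - c₀) + fun _ => c₀) = g by ext t; simp] at h2
    refine ⟨hmem.toLp g, fun c => ?_⟩
    rw [gShiftRisk_congr (hac.ae_le hmem.coeFn_toLp) c]
    exact hgN c
  have hcl (n : ℕ) : IsClosed (K n) := by
    refine IsSeqClosed.isClosed fun u g hu hg c => ?_
    obtain ⟨ns, -, hns⟩ := (tendstoInMeasure_of_tendsto_Lp hg).exists_seq_tendsto_ae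
    exact gShiftRisk_le_of_tendsto_ae (fun k => hmeas (u (ns k))) (hac.ae_le hns) c
      fun k => hu (ns k) c
  have hconv (n : ℕ) : Convex ℝ (K n) := by
    intro f hf g hg s t hs ht hst c
    have heq : (s • f + t • g : Lp ℝ 2 (gaussianReal c₀ 1)) =ᵐ[gaussianReal c₀ 1]
        fun x => s * f x + t * g x := by
      filter_upwards [Lp.coeFn_add (s • f) (t • g), Lp.coeFn_smul s f, Lp.coeFn_smul t g]
        with x h1 h2 h3
      rw [h1, Pi.add_apply, h2, h3, Pi.smul_apply, Pi.smul_apply, smul_eq_mul, smul_eq_mul]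
    rw [gShiftRisk_congr (hac.ae_le heq) c]
    exact gShiftRisk_convex_comb (hmeas f) hs ht hst c (hf c) (hg c)
  have hbdd : ∀ g ∈ K 0, ‖g‖ ≤ (N 0 c₀ ^ (1 / 2 : ℝ) +
      eLpNorm (fun _ : ℝ => c₀) 2 (gaussianReal c₀ 1)).toReal := by
    intro g hg
    rw [Lp.norm_def]
    refine ENNReal.toReal_mono (ENNReal.add_ne_top.2 ⟨hDfin, (memLp_const c₀).2.ne⟩) ?_
    have hg' : (g : ℝ → ℝ) = (fun t => g t - c₀) + fun _ => c₀ := by ext t; simp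
    have := hmeas g
    rw [hg']
    exact (eLpNorm_add_le (by fun_prop) (by fun_prop) (by norm_num)).trans
      (by gcongr; exact hsub (hg c₀))
  have hKanti : Antitone K := fun n m hnm g hg c => (hg c).trans (hanti hnm c)
  obtain ⟨g, hg⟩ := nonempty_iInter_of_antitone_convex hKanti hne hcl hconv hbdd
  exact ⟨g, hmeas g, fun n c => Set.mem_iInter.1 hg n c⟩

/-- The invariant estimator `y + ρ√Σ_U (g(t) - t)` generated by `g`. -/
noncomputable def shiftEstimator (sU ρ : ℝ) (g : ℝ → ℝ) : ℝ × ℝ → ℝ :=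
  fun p => ρ * Real.sqrt sU * g p.2 + p.1 - ρ * Real.sqrt sU * p.2

lemma measurable_shiftEstimator (sU ρ : ℝ) {g : ℝ → ℝ} (hg : Measurable g) :
    Measurable (shiftEstimator sU ρ g) := by
  unfold shiftEstimator
  fun_prop

lemma bivRisk_shiftEstimator {sU sO ρ : ℝ} (hsU : 0 < sU) (hρ : ρ ∈ Set.Ioo (-1 : ℝ) 1)
    (hρ0 : ρ ≠ 0) {g : ℝ → ℝ} (hg : Measurable g) (θ b : ℝ) :
    bivRisk sU sO ρ θ b (shiftEstimator sU ρ g) = ENNReal.ofReal (ρ ^ 2 * sU) *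
      (gShiftRisk g (b / Real.sqrt sO) + ENNReal.ofReal ((ρ ^ 2)⁻¹ - 1)) := by
  set c := b / Real.sqrt sO with hc
  have hρ1 : 0 < 1 - ρ ^ 2 := by nlinarith [hρ.1, hρ.2]
  have hρ2 : 0 < ρ ^ 2 := by positivity
  have hq : 0 ≤ (ρ ^ 2)⁻¹ - 1 := by
    rw [sub_nonneg]
    exact (one_le_inv₀ hρ2).2 (by linarith)
  have hm := measurable_shiftEstimator sU ρ hg
  rw [bivRisk, lintegral_prod_symm _ (by fun_prop)]
  have hinner (w : ℝ) : ∫⁻ z, ENNReal.ofReal ((shiftEstimator sU ρ g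
      (θ + Real.sqrt sU * (ρ * w + Real.sqrt (1 - ρ ^ 2) * z), c + w) - θ) ^ 2)
      ∂(gaussianReal 0 1) = ENNReal.ofReal (ρ ^ 2 * sU) *
      (ENNReal.ofReal ((g (c + w) - c) ^ 2) + ENNReal.ofReal ((ρ ^ 2)⁻¹ - 1)) := by
    have h1 := lintegral_ofReal_affine_sq_gaussianReal
      (Real.sqrt sU * Real.sqrt (1 - ρ ^ 2)) (ρ * Real.sqrt sU * (g (c + w) - c))
    rw [← ENNReal.ofReal_add (sq_nonneg _) hq, ← ENNReal.ofReal_mul (by positivity)]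
    convert h1 using 3
    · unfold shiftEstimator
      ring_nf
    · simp only [mul_pow, Real.sq_sqrt hsU.le, Real.sq_sqrt hρ1.le]
      field_simp
      ring
  refine (lintegral_congr hinner).trans ?_
  rw [lintegral_const_mul' _ _ ENNReal.ofReal_ne_top, lintegral_add_right _ measurable_const,
    ← gShiftRisk_eq_lintegral_standard hg]
  simp

/-- Averaging an estimator against a Gaussian prior on the location produces a function of the
second coordinate whose shift risk is controlled by the worst-case risk of the estimator. -/
lemma exists_gShiftRisk_le_iSup_bivRisk {sU sO ρ α : ℝ} (hsU : 0 < sU) (hρ0 : ρ ≠ 0)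
    (hα : Real.sin α ≠ 0) {δ : ℝ × ℝ → ℝ} (hδ : Measurable δ) :
    ∃ g : ℝ → ℝ, Measurable g ∧ ∀ b,
      ENNReal.ofReal ((Real.sqrt sU * Real.sqrt (1 - ρ ^ 2) * Real.cos α) ^ 2) +
        ENNReal.ofReal ((ρ * Real.sqrt sU) ^ 2) * gShiftRisk g (b / Real.sqrt sO)
      ≤ ⨆ θ, bivRisk sU sO ρ θ b δ := by
  set m := Real.sqrt sU * Real.sqrt (1 - ρ ^ 2) with hm
  set p := ρ * Real.sqrt sU with hp
  have hp0 : p ≠ 0 := mul_ne_zero hρ0 (Real.sqrt_pos.2 hsU).ne'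
  let g : ℝ → ℝ := fun t => ∫ x, (δ (p * t + m / Real.sin α * x, t) - m / Real.sin α * x) / p
    ∂(gaussianReal 0 1)
  have hg : Measurable g := by
    have hmeas : Measurable fun y : ℝ × ℝ =>
        (δ (p * y.1 + m / Real.sin α * y.2, y.1) - m / Real.sin α * y.2) / p := by fun_prop
    exact hmeas.stronglyMeasurable.integral_prod_right'.measurable
  refine ⟨g, hg, fun b => ?_⟩
  set c := b / Real.sqrt sO with hc
  let prior : ℝ → ℝ := fun u => p * c + m * Real.cos α / Real.sin α * u
  have hprior : Measurable prior := by fun_prop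
  calc _ = ∫⁻ w, (ENNReal.ofReal ((m * Real.cos α) ^ 2) +
          ENNReal.ofReal (p ^ 2) * ENNReal.ofReal ((g (c + w) - c) ^ 2)) ∂(gaussianReal 0 1) := by
        rw [lintegral_add_left measurable_const, lintegral_const_mul' _ _ ENNReal.ofReal_ne_top,
          ← gShiftRisk_eq_lintegral_standard hg]
        simp
    _ ≤ ∫⁻ w, ∫⁻ x : ℝ × ℝ, ENNReal.ofReal ((δ (prior x.1 +
          Real.sqrt sU * (ρ * w + Real.sqrt (1 - ρ ^ 2) * x.2), c + w) - prior x.1) ^ 2)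
          ∂((gaussianReal 0 1).prod (gaussianReal 0 1)) ∂(gaussianReal 0 1) := by
        refine lintegral_mono fun w => ?_
        have h := gaussian_bayes_bound (m := m) hp0 hα c
          (f := fun x => δ (p * (c + w) + x, c + w)) (by fun_prop)
        refine h.trans (le_of_eq (lintegral_congr fun x => ?_))
        simp only [prior, hm, hp]
        ring_nf
    _ = ∫⁻ w, ∫⁻ u, ∫⁻ z, ENNReal.ofReal ((δ (prior u +
          Real.sqrt sU * (ρ * w + Real.sqrt (1 - ρ ^ 2) * z), c + w) - prior u) ^ 2)
          ∂(gaussianReal 0 1) ∂(gaussianReal 0 1) ∂(gaussianReal 0 1) := by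
        refine lintegral_congr fun w => ?_
        rw [lintegral_prod _ (by fun_prop)]
    _ = ∫⁻ u, bivRisk sU sO ρ (prior u) b δ ∂(gaussianReal 0 1) := by
        have hmeas : Measurable fun y : (ℝ × ℝ) × ℝ => ENNReal.ofReal ((δ (prior y.1.2 +
          Real.sqrt sU * (ρ * y.1.1 + Real.sqrt (1 - ρ ^ 2) * y.2), c + y.1.1)
          - prior y.1.2) ^ 2) := by fun_prop
        rw [lintegral_lintegral_swap hmeas.lintegral_prod_right'.aemeasurable]
        refine lintegral_congr fun u => ?_
        rw [bivRisk, lintegral_prod_symm _ (by fun_prop)]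
    _ ≤ ∫⁻ _, ⨆ θ, bivRisk sU sO ρ θ b δ ∂(gaussianReal 0 1) :=
        lintegral_mono fun u => le_iSup (fun θ => bivRisk sU sO ρ θ b δ) (prior u)
    _ = ⨆ θ, bivRisk sU sO ρ θ b δ := by simp

/-- Hunt–Stein reduction: every estimator is dominated, in risk maximized over `θ`, by an invariant
estimator, simultaneously for all biases. -/
lemma exists_shiftEstimator_dominates {sU sO ρ : ℝ} (hsU : 0 < sU) (hsO : 0 < sO)
    (hρ : ρ ∈ Set.Ioo (-1 : ℝ) 1) (hρ0 : ρ ≠ 0) {δ : ℝ × ℝ → ℝ} (hδ : Measurable δ) :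
    ∃ g : ℝ → ℝ, Measurable g ∧ ∀ θ b,
      bivRisk sU sO ρ θ b (shiftEstimator sU ρ g) ≤ ⨆ θ', bivRisk sU sO ρ θ' b δ := by
  have hsO' : Real.sqrt sO ≠ 0 := (Real.sqrt_pos.2 hsO).ne'
  have hρ1 : 0 < 1 - ρ ^ 2 := by nlinarith [hρ.1, hρ.2]
  have hρ2 : 0 < ρ ^ 2 := by positivity
  by_cases hfin : ∃ b₀, (⨆ θ', bivRisk sU sO ρ θ' b₀ δ) ≠ ∞
  swap
  · push Not at hfin
    exact ⟨0, measurable_const, fun θ b => by simp [hfin b]⟩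
  obtain ⟨b₀, hb₀⟩ := hfin
  have hk0 : ENNReal.ofReal ((ρ * Real.sqrt sU) ^ 2) ≠ 0 := by
    have := Real.sqrt_pos.2 hsU
    rw [Ne, ENNReal.ofReal_eq_zero, not_le]
    positivity
  let α : ℕ → ℝ := fun n => 1 / ((n : ℝ) + 1)
  have hα0 (n : ℕ) : 0 < α n := Nat.one_div_pos_of_nat
  have hα1 (n : ℕ) : α n ≤ 1 := by
    rw [div_le_one (by positivity)]
    linarith [n.cast_nonneg (α := ℝ)]
  have hpi := Real.pi_gt_three
  have hsin (n : ℕ) : Real.sin (α n) ≠ 0 :=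
    (Real.sin_pos_of_pos_of_lt_pi (hα0 n) (by linarith [hα1 n])).ne'
  have hcos (n : ℕ) : 0 ≤ Real.cos (α n) :=
    Real.cos_nonneg_of_neg_pi_div_two_le_of_le (by linarith [hα0 n]) (by linarith [hα1 n])
  let A : ℕ → ℝ≥0∞ := fun n =>
    ENNReal.ofReal ((Real.sqrt sU * Real.sqrt (1 - ρ ^ 2) * Real.cos (α n)) ^ 2)
  have hA : Monotone A := fun n k hnk => by
    have h1 : Real.cos (α n) ≤ Real.cos (α k) :=
      Real.cos_le_cos_of_nonneg_of_le_pi (hα0 k).le (by linarith [hα1 n])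
        (Nat.one_div_le_one_div hnk)
    have h2 := hcos n
    exact ENNReal.ofReal_le_ofReal (by gcongr)
  have hAlim : Tendsto A atTop (𝓝 (ENNReal.ofReal (sU * (1 - ρ ^ 2)))) := by
    have h1 : Tendsto (fun n => Real.cos (α n)) atTop (𝓝 (Real.cos 0)) :=
      (Real.continuous_cos.tendsto 0).comp tendsto_one_div_add_atTop_nhds_zero_nat
    have h2 := (ENNReal.continuous_ofReal.tendsto _).comp
      ((h1.const_mul (Real.sqrt sU * Real.sqrt (1 - ρ ^ 2))).pow 2)
    rwa [Real.cos_zero, mul_one, mul_pow, Real.sq_sqrt hsU.le, Real.sq_sqrt hρ1.le] at h2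
  let M : ℝ → ℝ≥0∞ := fun c => ⨆ θ', bivRisk sU sO ρ θ' (Real.sqrt sO * c) δ
  let N : ℕ → ℝ → ℝ≥0∞ := fun n c => (M c - A n) / ENNReal.ofReal ((ρ * Real.sqrt sU) ^ 2)
  have hdiv (c : ℝ) : Real.sqrt sO * c / Real.sqrt sO = c := by field_simp
  have hbound (n : ℕ) : ∃ g : ℝ → ℝ, Measurable g ∧ ∀ c, A n +
      ENNReal.ofReal ((ρ * Real.sqrt sU) ^ 2) * gShiftRisk g c ≤ M c := by
    obtain ⟨g, hg, h⟩ := exists_gShiftRisk_le_iSup_bivRisk (sO := sO) hsU hρ0 (hsin n) hδ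
    refine ⟨g, hg, fun c => ?_⟩
    have h1 := h (Real.sqrt sO * c)
    rwa [hdiv] at h1
  have hAM (n : ℕ) (c : ℝ) : A n ≤ M c := by
    obtain ⟨g, -, h⟩ := hbound n
    exact le_self_add.trans (h c)
  obtain ⟨g, hg, hgN⟩ := exists_forall_gShiftRisk_le (N := N) (c₀ := b₀ / Real.sqrt sO)
    (fun n k hnk c => ENNReal.div_le_div_right (tsub_le_tsub_left (hA hnk) _) _)
    (fun n => by
      obtain ⟨g, hg, h⟩ := hbound n
      refine ⟨g, hg, fun c => ?_⟩
      rw [ENNReal.le_div_iff_mul_le (Or.inl hk0) (Or.inl ENNReal.ofReal_ne_top), mul_comm]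
      exact ENNReal.le_sub_of_add_le_left ENNReal.ofReal_ne_top (h c))
    (by
      refine ENNReal.div_ne_top (ENNReal.sub_ne_top ?_) hk0
      simp only [M]
      rwa [mul_div_cancel₀ _ hsO'])
  refine ⟨g, hg, fun θ b => ?_⟩
  rw [bivRisk_shiftEstimator hsU hρ hρ0 hg, mul_add, ← ENNReal.ofReal_mul (by positivity), add_comm]
  have hMb : M (b / Real.sqrt sO) = ⨆ θ', bivRisk sU sO ρ θ' b δ := by
    simp only [M]
    rw [mul_div_cancel₀ _ hsO']
  rw [← hMb, show ρ ^ 2 * sU * ((ρ ^ 2)⁻¹ - 1) = sU * (1 - ρ ^ 2) by field_simp]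
  refine le_of_tendsto' (hAlim.add_const _) fun n => ?_
  have h1 := hgN n (b / Real.sqrt sO)
  simp only [N] at h1
  rw [ENNReal.le_div_iff_mul_le (Or.inl hk0) (Or.inl ENNReal.ofReal_ne_top), mul_comm,
    mul_pow, Real.sq_sqrt hsU.le] at h1
  calc _ ≤ A n + (M (b / Real.sqrt sO) - A n) := by gcongr
    _ = _ := add_tsub_cancel_of_le (hAM n _)

lemma exists_bivRmax_shiftEstimator_le {sU sO ρ : ℝ} (hsU : 0 < sU) (hsO : 0 < sO)
    (hρ : ρ ∈ Set.Ioo (-1 : ℝ) 1) (hρ0 : ρ ≠ 0) {δ : ℝ × ℝ → ℝ} (hδ : Measurable δ) :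
    ∃ g : ℝ → ℝ, Measurable g ∧ ∀ B,
      bivRmax sU sO ρ B (shiftEstimator sU ρ g) ≤ bivRmax sU sO ρ B δ := by
  obtain ⟨g, hg, h⟩ := exists_shiftEstimator_dominates hsU hsO hρ hρ0 hδ
  refine ⟨g, hg, fun B => iSup_le fun θ => iSup_le fun b => (h θ b).trans ?_⟩
  exact iSup_mono fun θ' => le_iSup (fun b : {b : ℝ // ENNReal.ofReal |b| ≤ B} =>
    bivRisk sU sO ρ θ' b δ) b

lemma bivRmax_shiftEstimator {sU sO ρ : ℝ} (hsU : 0 < sU)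
    (hρ : ρ ∈ Set.Ioo (-1 : ℝ) 1) (hρ0 : ρ ≠ 0) {g : ℝ → ℝ} (hg : Measurable g) (B : ℝ≥0∞) :
    bivRmax sU sO ρ B (shiftEstimator sU ρ g) =
      ⨆ b : {b : ℝ // ENNReal.ofReal |b| ≤ B}, ENNReal.ofReal (ρ ^ 2 * sU) *
        (gShiftRisk g (b / Real.sqrt sO) + ENNReal.ofReal ((ρ ^ 2)⁻¹ - 1)) := by
  simp_rw [bivRmax, bivRisk_shiftEstimator hsU hρ hρ0 hg]
  exact iSup_const

lemma bivRstar_eq_rBNM {sU sO ρ : ℝ} (hsU : 0 < sU) (hsO : 0 < sO)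
    (hρ : ρ ∈ Set.Ioo (-1 : ℝ) 1) (hρ0 : ρ ≠ 0) (c : ℝ) :
    bivRstar sU sO ρ (ENNReal.ofReal |Real.sqrt sO * c|) = ENNReal.ofReal (ρ ^ 2 * sU) *
      (rBNM |c| + ENNReal.ofReal ((ρ ^ 2)⁻¹ - 1)) := by
  have hsO' : 0 < Real.sqrt sO := Real.sqrt_pos.2 hsO
  have hk0 : ENNReal.ofReal (ρ ^ 2 * sU) ≠ 0 := by
    rw [Ne, ENNReal.ofReal_eq_zero, not_le]
    positivity
  have hmax {g : ℝ → ℝ} (hg : Measurable g) :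
      bivRmax sU sO ρ (ENNReal.ofReal |Real.sqrt sO * c|) (shiftEstimator sU ρ g) =
        ENNReal.ofReal (ρ ^ 2 * sU) *
          ((⨆ μ ∈ Set.Icc (-|c|) |c|, gShiftRisk g μ) + ENNReal.ofReal ((ρ ^ 2)⁻¹ - 1)) := by
    rw [bivRmax_shiftEstimator hsU hρ hρ0 hg]
    apply le_antisymm
    · refine iSup_le fun ⟨b, hb⟩ => ?_
      rw [ENNReal.ofReal_le_ofReal_iff (abs_nonneg _), abs_mul, abs_of_pos hsO'] at hb
      gcongr
      refine le_iSup₂ (f := fun μ (_ : μ ∈ Set.Icc (-|c|) |c|) => gShiftRisk g μ)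
        (b / Real.sqrt sO) (abs_le.1 ?_)
      rw [abs_div, abs_of_pos hsO', div_le_iff₀ hsO']
      linarith
    · have hne : (Set.Icc (-|c|) |c|).Nonempty := ⟨0, by simp⟩
      rw [ENNReal.biSup_add hne, ENNReal.mul_iSup]
      simp_rw [ENNReal.mul_iSup]
      refine iSup₂_le fun μ hμ => ?_
      refine le_trans (le_of_eq ?_) (le_iSup _ ⟨Real.sqrt sO * μ, ENNReal.ofReal_le_ofReal ?_⟩)
      · simp only
        rw [mul_div_cancel_left₀ _ hsO'.ne']
      · rw [abs_mul, abs_mul]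
        exact mul_le_mul_of_nonneg_left (abs_le.2 hμ) (abs_nonneg _)
  rw [rBNM, ENNReal.iInf_add, ENNReal.mul_iInf_of_ne hk0 ENNReal.ofReal_ne_top]
  apply le_antisymm
  · refine le_iInf fun g => ?_
    rw [← hmax g.2]
    exact iInf_le (fun f : {f : ℝ × ℝ → ℝ // Measurable f} =>
      bivRmax sU sO ρ (ENNReal.ofReal |Real.sqrt sO * c|) f)
      ⟨_, measurable_shiftEstimator sU ρ g.2⟩
  · refine le_iInf fun δ => ?_
    obtain ⟨g, hg, h⟩ := exists_bivRmax_shiftEstimator_le hsU hsO hρ hρ0 δ.2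
    refine le_trans ?_ (h _)
    rw [hmax hg]
    exact iInf_le (fun f : {f : ℝ → ℝ // Measurable f} => ENNReal.ofReal (ρ ^ 2 * sU) *
      ((⨆ μ ∈ Set.Icc (-|c|) |c|, gShiftRisk f μ) + ENNReal.ofReal ((ρ ^ 2)⁻¹ - 1))) ⟨g, hg⟩

lemma bivRstar_mono (sU sO ρ : ℝ) : Monotone (bivRstar sU sO ρ) := fun _ _ hB =>
  iInf_mono fun δ => iSup_mono fun θ => iSup_le fun b =>
    le_iSup (fun b' : {b : ℝ // ENNReal.ofReal |b| ≤ _} => bivRisk sU sO ρ θ b' δ)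
      ⟨b, b.2.trans hB⟩

lemma bivRegret_shiftEstimator {sU sO ρ : ℝ} (hsU : 0 < sU) (hsO : 0 < sO)
    (hρ : ρ ∈ Set.Ioo (-1 : ℝ) 1) (hρ0 : ρ ≠ 0) {g : ℝ → ℝ} (hg : Measurable g) :
    bivRegret sU sO ρ (shiftEstimator sU ρ g) = adaptObj ρ g := by
  have hsO' : Real.sqrt sO ≠ 0 := (Real.sqrt_pos.2 hsO).ne'
  have hk0 : ENNReal.ofReal (ρ ^ 2 * sU) ≠ 0 := by
    rw [Ne, ENNReal.ofReal_eq_zero, not_le]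
    positivity
  have hratio (c : ℝ) : ENNReal.ofReal (ρ ^ 2 * sU) *
      (gShiftRisk g c + ENNReal.ofReal ((ρ ^ 2)⁻¹ - 1)) /
        bivRstar sU sO ρ (ENNReal.ofReal |Real.sqrt sO * c|) =
      (gShiftRisk g c + ENNReal.ofReal ((ρ ^ 2)⁻¹ - 1)) /
        (rBNM |c| + ENNReal.ofReal ((ρ ^ 2)⁻¹ - 1)) := by
    rw [bivRstar_eq_rBNM hsU hsO hρ hρ0, ENNReal.mul_div_mul_left _ _ hk0 ENNReal.ofReal_ne_top]
  apply le_antisymm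
  · refine iSup_le fun B => ?_
    rw [bivRmax_shiftEstimator hsU hρ hρ0 hg, ENNReal.iSup_div]
    refine iSup_le fun ⟨b, hb⟩ => ?_
    refine le_trans ?_ (le_iSup _ (b / Real.sqrt sO))
    rw [← hratio, mul_div_cancel₀ _ hsO']
    exact ENNReal.div_le_div_left (bivRstar_mono sU sO ρ hb) _
  · refine iSup_le fun c => ?_
    rw [← hratio]
    refine le_trans ?_ (le_iSup _ (ENNReal.ofReal |Real.sqrt sO * c|))
    rw [bivRmax_shiftEstimator hsU hρ hρ0 hg]
    gcongr
    refine le_trans (le_of_eq ?_) (le_iSup _ ⟨Real.sqrt sO * c, le_rfl⟩)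
    simp only
    rw [mul_div_cancel_left₀ _ hsO']

/-- **The optimally adaptive estimator.**  If the measurable function `δ̃` minimizes the
adaptation objective `A(·, ρ)` over all measurable functions, then the estimator
`δ^adapt(Y_U, T_O) = ρ·√Σ_U·δ̃(T_O) + Y_U − ρ·√Σ_U·T_O` minimizes the worst-case
adaptation regret `sup_{B ∈ [0,∞]} R_max(B, δ)/R*(B)` over all measurable estimators. -/
theorem stmt_2 (sU sO ρ : ℝ) (hsU : 0 < sU) (hsO : 0 < sO)
    (hρ : ρ ∈ Set.Ioo (-1 : ℝ) 1) (hρ0 : ρ ≠ 0)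
    (δt : ℝ → ℝ) (hδt : Measurable δt)
    (hopt : ∀ g : ℝ → ℝ, Measurable g → adaptObj ρ δt ≤ adaptObj ρ g) :
    ∀ δ : ℝ × ℝ → ℝ, Measurable δ →
      bivRegret sU sO ρ
        (fun p => ρ * Real.sqrt sU * δt p.2 + p.1 - ρ * Real.sqrt sU * p.2)
      ≤ bivRegret sU sO ρ δ := by
  intro δ hδ
  obtain ⟨g, hg, h⟩ := exists_bivRmax_shiftEstimator_le hsU hsO hρ hρ0 hδ
  calc bivRegret sU sO ρ (shiftEstimator sU ρ δt)
      = adaptObj ρ δt := bivRegret_shiftEstimator hsU hsO hρ hρ0 hδt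
    _ ≤ adaptObj ρ g := hopt g hg
    _ = bivRegret sU sO ρ (shiftEstimator sU ρ g) :=
        (bivRegret_shiftEstimator hsU hsO hρ hρ0 hg).symm
    _ ≤ bivRegret sU sO ρ δ := iSup_mono fun B => ENNReal.div_le_div_right (h B) _
end

section
/- For every ρ ∈ (−1, 1) with ρ ≠ 0, a minimax theorem holds for the adaptation objective: inf over measurable δ̃: ℝ → ℝ of sup_{b̃ ∈ ℝ} (r(δ̃, b̃) + ρ^{−2} − 1)/(r^BNM(|b̃|) + ρ^{−2} − 1) equals sup over Borel probability measures π on ℝ of inf over measurable δ̃: ℝ → ℝ of ∫ (r(δ̃, b̃) + ρ^{−2} − 1)/(r^BNM(|b̃|) + ρ^{−2} − 1) dπ(b̃). -/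
open MeasureTheory ProbabilityTheory
open scoped ENNReal

/-- Finite minimax: if no `x` has all losses at most `c`, some prior on the finite index set makes
every averaged loss at least `c`. -/
theorem exists_weights_of_forall_exists_lt {X ι : Type*} [Nonempty X] [Fintype ι]
    (L : X → ι → ℝ≥0∞)
    (hconv : ∀ x y, ∀ s t : ℝ, 0 ≤ s → 0 ≤ t → s + t = 1 →
      ∃ z, ∀ i, L z i ≤ ENNReal.ofReal s * L x i + ENNReal.ofReal t * L y i)
    (hfin : ∀ x, ∃ z, ∀ i, L z i ≤ L x i ∧ L z i ≠ ⊤)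
    (c : ℝ) (hc : ∀ x, ∃ i, ENNReal.ofReal c < L x i) :
    ∃ p : ι → ℝ≥0∞, ∑ i, p i = 1 ∧ ∀ x, ENNReal.ofReal c ≤ ∑ i, p i * L x i := by
  classical
  let A : Set (ι → ℝ) := {y | ∃ x, ∀ i, 0 ≤ y i ∧ L x i ≤ ENNReal.ofReal (y i)}
  let B : Set (ι → ℝ) := Set.univ.pi fun _ => Set.Iio c
  have hA : Convex ℝ A := by
    rintro y ⟨x, hx⟩ y' ⟨x', hx'⟩ s t hs ht hst
    obtain ⟨z, hz⟩ := hconv x x' s t hs ht hst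
    refine ⟨z, fun i => ⟨?_, (hz i).trans ?_⟩⟩
    · exact add_nonneg (mul_nonneg hs (hx i).1) (mul_nonneg ht (hx' i).1)
    · simp only [Pi.add_apply, Pi.smul_apply, smul_eq_mul]
      rw [ENNReal.ofReal_add (mul_nonneg hs (hx i).1) (mul_nonneg ht (hx' i).1),
        ENNReal.ofReal_mul hs, ENNReal.ofReal_mul ht]
      gcongr
      exacts [(hx i).2, (hx' i).2]
  have hB : Convex ℝ B := convex_pi fun _ _ => convex_Iio c
  have hBo : IsOpen B := isOpen_set_pi Set.finite_univ fun _ _ => isOpen_Iio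
  have hAB : Disjoint B A := by
    rw [Set.disjoint_left]
    rintro y hy ⟨x, hx⟩
    obtain ⟨i, hi⟩ := hc x
    exact absurd ((hx i).2.trans (ENNReal.ofReal_le_ofReal (hy i trivial).le)) hi.not_ge
  have hAmem : ∀ x, (∀ i, L x i ≠ ⊤) → (fun i => (L x i).toReal) ∈ A := fun x hx =>
    ⟨x, fun i => ⟨ENNReal.toReal_nonneg, (ENNReal.ofReal_toReal (hx i)).ge⟩⟩
  obtain ⟨f, u, hfB, hfA⟩ := geometric_hahn_banach_open hB hBo hA hAB
  let q : ι → ℝ := fun i => f (Pi.single i 1)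
  have hf : ∀ y, f y = ∑ i, y i * q i := fun y => by
    conv_lhs => rw [← Finset.univ_sum_single y]
    rw [map_sum]
    refine Finset.sum_congr rfl fun i _ => ?_
    rw [← smul_eq_mul, ← map_smul, ← Pi.single_smul, smul_eq_mul, mul_one]
  have hq : ∀ i, 0 ≤ q i := by
    intro i
    by_contra! hi
    let a := f fun _ => c - 1
    let N := |u - a| / -q i
    have hN : 0 ≤ N := div_nonneg (abs_nonneg _) (neg_nonneg.2 hi.le)
    have h := hfB ((fun _ => c - 1) - N • Pi.single i (1 : ℝ)) fun j _ => by
      have : 0 ≤ N * (Pi.single i (1 : ℝ) : ι → ℝ) j :=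
        mul_nonneg hN ((Pi.single_nonneg.2 zero_le_one : (0 : ι → ℝ) ≤ Pi.single i 1) j)
      simp only [Pi.sub_apply, Pi.smul_apply, smul_eq_mul, Set.mem_Iio]
      linarith
    rw [map_sub, map_smul, smul_eq_mul] at h
    have hNq : N * q i = -|u - a| := by
      simp only [N]
      field_simp [hi.ne]
    change a - N * q i < u at h
    linarith [le_abs_self (u - a)]
  let S := ∑ i, q i
  obtain ⟨x₀⟩ := ‹Nonempty X›
  obtain ⟨z₀, hz₀⟩ := hfin x₀
  have hS : 0 < S := by
    refine (Finset.sum_nonneg fun i _ => hq i).lt_of_ne fun h => ?_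
    have hq0 : ∀ i, q i = 0 := fun i =>
      (Finset.sum_eq_zero_iff_of_nonneg fun i _ => hq i).1 h.symm i (Finset.mem_univ i)
    have h1 := hfB (fun _ => c - 1) fun i _ => by simp
    have h2 := hfA _ (hAmem z₀ fun i => (hz₀ i).2)
    simp only [hf, hq0, mul_zero, Finset.sum_const_zero] at h1 h2
    linarith
  have hcS : c * S ≤ u := by
    by_contra! h
    have h1 := hfB (fun _ => u / S) fun i _ => (div_lt_iff₀ hS).2 h
    rw [hf, ← Finset.mul_sum, div_mul_cancel₀ _ hS.ne'] at h1
    exact lt_irrefl _ h1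
  refine ⟨fun i => ENNReal.ofReal (q i / S), ?_, fun x => ?_⟩
  · rw [← ENNReal.ofReal_sum_of_nonneg fun i _ => div_nonneg (hq i) hS.le, ← Finset.sum_div,
      div_self hS.ne', ENNReal.ofReal_one]
  · obtain ⟨z, hz⟩ := hfin x
    have h1 := hfA _ (hAmem z fun i => (hz i).2)
    rw [hf] at h1
    calc ENNReal.ofReal c ≤ ENNReal.ofReal (∑ i, q i / S * (L z i).toReal) := by
          refine ENNReal.ofReal_le_ofReal ?_
          rw [← le_div_iff₀ hS] at hcS
          refine hcS.trans ((div_le_div_of_nonneg_right h1 hS.le).trans_eq ?_)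
          rw [Finset.sum_div]
          exact Finset.sum_congr rfl fun i _ => by ring
      _ = ∑ i, ENNReal.ofReal (q i / S) * L z i := by
          rw [ENNReal.ofReal_sum_of_nonneg fun i _ =>
            mul_nonneg (div_nonneg (hq i) hS.le) ENNReal.toReal_nonneg]
          refine Finset.sum_congr rfl fun i _ => ?_
          rw [ENNReal.ofReal_mul (div_nonneg (hq i) hS.le), ENNReal.ofReal_toReal (hz i).2]
      _ ≤ _ := by
          gcongr with i
          exact (hz i).1

/-- Finite intersection property for closed convex sets in a Hilbert space, one of them bounded. -/
theorem nonempty_iInter_of_convex_of_isClosed {H ι : Type*} [NormedAddCommGroup H]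
    [InnerProductSpace ℝ H] [CompleteSpace H] (C : ι → Set H) (hconv : ∀ i, Convex ℝ (C i))
    (hclosed : ∀ i, IsClosed (C i)) (i₀ : ι) (hbdd : Bornology.IsBounded (C i₀))
    (hne : ∀ F : Finset ι, (⋂ i ∈ F, C i).Nonempty) : (⋂ i, C i).Nonempty := by
  classical
  let K : Finset ι → Set H := fun F => ⋂ i ∈ insert i₀ F, C i
  have hKconv : ∀ F, Convex ℝ (K F) := fun F => convex_iInter₂ fun i _ => hconv i
  have hKanti : ∀ {F G}, F ≤ G → K G ⊆ K F := fun h =>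
    Set.biInter_subset_biInter_left fun i hi => Finset.insert_subset_insert i₀ h hi
  have hmin : ∀ F, ∃ v ∈ K F, ∀ w ∈ K F, ‖w - v‖ ^ 2 ≤ ‖w‖ ^ 2 - ‖v‖ ^ 2 := by
    intro F
    obtain ⟨v, hv, h⟩ := exists_norm_eq_iInf_of_complete_convex (hne (insert i₀ F))
      (isClosed_biInter fun i _ => hclosed i).isComplete (hKconv F) 0
    refine ⟨v, hv, fun w hw => ?_⟩
    have h1 := (norm_eq_iInf_iff_real_inner_le_zero (hKconv F) hv).1 h w hw
    rw [zero_sub, inner_neg_left, inner_sub_right, real_inner_self_eq_norm_sq,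
      real_inner_comm] at h1
    rw [norm_sub_sq_real]
    linarith
  choose x hxK hx using hmin
  have hxx : ∀ {F G}, F ≤ G → ‖x G - x F‖ ^ 2 ≤ ‖x G‖ ^ 2 - ‖x F‖ ^ 2 := fun h =>
    hx _ _ (hKanti h (hxK _))
  have hmono : Monotone fun F => ‖x F‖ ^ 2 := fun F G h =>
    sub_nonneg.1 ((sq_nonneg _).trans (hxx h))
  obtain ⟨R, hR⟩ := hbdd.exists_norm_le
  have hbd : BddAbove (Set.range fun F => ‖x F‖ ^ 2) := by
    refine ⟨R ^ 2, ?_⟩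
    rintro _ ⟨F, rfl⟩
    exact pow_le_pow_left₀ (norm_nonneg _)
      (hR _ (Set.mem_iInter₂.1 (hxK F) i₀ (Finset.mem_insert_self _ _))) 2
  have hcau : CauchySeq x := by
    have h := (tendsto_atTop_ciSup hmono hbd).cauchySeq
    rw [Metric.cauchySeq_iff'] at h ⊢
    intro ε hε
    obtain ⟨N, hN⟩ := h (ε ^ 2) (by positivity)
    refine ⟨N, fun F hF => ?_⟩
    rw [dist_eq_norm]
    refine lt_of_pow_lt_pow_left₀ 2 hε.le ((hxx hF).trans_lt ?_)
    exact (le_abs_self _).trans_lt (hN F hF)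
  obtain ⟨a, ha⟩ := cauchySeq_tendsto_of_complete hcau
  refine ⟨a, Set.mem_iInter.2 fun i => (hclosed i).mem_of_tendsto ha ?_⟩
  filter_upwards [Filter.eventually_ge_atTop {i}] with F hF
  exact Set.mem_iInter₂.1 (hxK F) i
    (Finset.mem_insert_of_mem (Finset.singleton_subset_iff.1 hF))

theorem gShiftRisk_congr_s3 {δ δ' : ℝ → ℝ} (h : δ =ᵐ[gaussianReal 0 1] δ') (b : ℝ) :
    gShiftRisk δ b = gShiftRisk δ' b := by
  have hac : gaussianReal b 1 ≪ gaussianReal 0 1 :=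
    (gaussianReal_absolutelyContinuous b one_ne_zero).trans
      (gaussianReal_absolutelyContinuous' 0 one_ne_zero)
  refine lintegral_congr_ae ((hac.ae_eq h).mono fun t ht => ?_)
  simp only [ht]

theorem gShiftRisk_convex {δ δ' : ℝ → ℝ} (hδ : Measurable δ) (hδ' : Measurable δ') {s t : ℝ}
    (hs : 0 ≤ s) (ht : 0 ≤ t) (hst : s + t = 1) (b : ℝ) :
    gShiftRisk (fun x => s * δ x + t * δ' x) b ≤
      ENNReal.ofReal s * gShiftRisk δ b + ENNReal.ofReal t * gShiftRisk δ' b := by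
  unfold gShiftRisk
  rw [← lintegral_const_mul _ (by fun_prop), ← lintegral_const_mul _ (by fun_prop),
    ← lintegral_add_left (by fun_prop)]
  refine lintegral_mono fun x => ?_
  rw [← ENNReal.ofReal_mul hs, ← ENNReal.ofReal_mul ht, ← ENNReal.ofReal_add (by positivity)
    (by positivity)]
  refine ENNReal.ofReal_le_ofReal ?_
  obtain rfl : t = 1 - s := by linarith
  nlinarith [mul_nonneg (mul_nonneg hs ht) (sq_nonneg (δ' x - δ x))]

/-- Clipping to `[-M, M]` lowers the risk at every `b` in that interval and makes it finite. -/
theorem gShiftRisk_clip {δ : ℝ → ℝ} {M b : ℝ} (hb : |b| ≤ M) :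
    gShiftRisk (fun x => max (-M) (min M (δ x))) b ≤ gShiftRisk δ b ∧
      gShiftRisk (fun x => max (-M) (min M (δ x))) b ≠ ⊤ := by
  obtain ⟨h1, h2⟩ := abs_le.1 hb
  constructor
  · refine lintegral_mono fun x => ENNReal.ofReal_le_ofReal (sq_le_sq.2 ?_)
    grind
  · have : gShiftRisk (fun x => max (-M) (min M (δ x))) b ≤
        ∫⁻ _, ENNReal.ofReal ((2 * M) ^ 2) ∂(gaussianReal b 1) := by
      refine lintegral_mono fun x => ENNReal.ofReal_le_ofReal (sq_le_sq' ?_ ?_)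
      · linarith [le_max_left (-M) (min M (δ x))]
      · have : max (-M) (min M (δ x)) ≤ M := max_le (by linarith) (min_le_left _ _)
        linarith
    refine ne_top_of_le_ne_top ?_ this
    simp

/-- Sublevel sets of the risk at `b` are closed in `L²(N(0,1))`. -/
theorem isClosed_gShiftRisk_le (b : ℝ) (a : ℝ≥0∞) :
    IsClosed {f : Lp ℝ 2 (gaussianReal 0 1) | gShiftRisk f b ≤ a} := by
  have hac : gaussianReal b 1 ≪ gaussianReal 0 1 :=
    (gaussianReal_absolutelyContinuous b one_ne_zero).trans
      (gaussianReal_absolutelyContinuous' 0 one_ne_zero)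
  rw [← isSeqClosed_iff_isClosed]
  intro f g hf hfg
  obtain ⟨ns, -, hns⟩ := (tendstoInMeasure_of_tendsto_Lp hfg).exists_seq_tendsto_ae
  have hmeas : ∀ n, Measurable (f n) := fun n => (Lp.stronglyMeasurable (f n)).measurable
  calc gShiftRisk g b
      = ∫⁻ x, Filter.liminf (fun n => ENNReal.ofReal ((f (ns n) x - b) ^ 2)) Filter.atTop
          ∂(gaussianReal b 1) := by
        refine lintegral_congr_ae ((hns.filter_mono hac.ae_le).mono fun x hx => ?_)
        refine (Filter.Tendsto.liminf_eq ?_).symm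
        exact ENNReal.tendsto_ofReal ((hx.sub_const b).pow 2)
    _ ≤ Filter.liminf (fun n => gShiftRisk (f (ns n)) b) Filter.atTop :=
        lintegral_liminf_le fun n => by have := hmeas (ns n); fun_prop
    _ ≤ a := Filter.liminf_le_of_frequently_le' (Filter.Frequently.of_forall fun n => hf (ns n))

theorem convex_gShiftRisk_le (b : ℝ) (a : ℝ≥0∞) :
    Convex ℝ {f : Lp ℝ 2 (gaussianReal 0 1) | gShiftRisk f b ≤ a} := by
  intro f hf g hg s t hs ht hst
  have hmeas (f : Lp ℝ 2 (gaussianReal 0 1)) : Measurable f := (Lp.stronglyMeasurable f).measurable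
  have hae : (s • f + t • g : Lp ℝ 2 (gaussianReal 0 1)) =ᵐ[gaussianReal 0 1]
      fun x => s * f x + t * g x := by
    filter_upwards [Lp.coeFn_add (s • f) (t • g), Lp.coeFn_smul s f, Lp.coeFn_smul t g]
      with x h1 h2 h3
    rw [h1, Pi.add_apply, h2, h3]
    rfl
  rw [Set.mem_ofPred_eq, gShiftRisk_congr_s3 hae]
  calc _ ≤ ENNReal.ofReal s * gShiftRisk f b + ENNReal.ofReal t * gShiftRisk g b :=
        gShiftRisk_convex (hmeas f) (hmeas g) hs ht hst b
    _ ≤ ENNReal.ofReal s * a + ENNReal.ofReal t * a := by gcongr <;> assumption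
    _ = a := by rw [← add_mul, ← ENNReal.ofReal_add hs ht, hst, ENNReal.ofReal_one, one_mul]

theorem eLpNorm_two_eq_gShiftRisk_zero (δ : ℝ → ℝ) :
    eLpNorm δ 2 (gaussianReal 0 1) = gShiftRisk δ 0 ^ (1 / 2 : ℝ) := by
  rw [eLpNorm_eq_lintegral_rpow_enorm_toReal two_ne_zero ENNReal.ofNat_ne_top, gShiftRisk]
  simp only [ENNReal.toReal_ofNat, sub_zero, ENNReal.rpow_ofNat]
  congr 2
  ext x
  rw [Real.enorm_eq_ofReal_abs, ← ENNReal.ofReal_pow (abs_nonneg _), sq_abs]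

/-- Risk constraints that are jointly satisfiable on every finite set of parameters are jointly
satisfiable. -/
theorem exists_forall_gShiftRisk_le_s3 (a : ℝ → ℝ≥0∞) (ha : a 0 ≠ ⊤)
    (h : ∀ F : Finset ℝ, ∃ δ : ℝ → ℝ, Measurable δ ∧ ∀ b ∈ F, gShiftRisk δ b ≤ a b) :
    ∃ δ : ℝ → ℝ, Measurable δ ∧ ∀ b, gShiftRisk δ b ≤ a b := by
  classical
  obtain ⟨f, hf⟩ := nonempty_iInter_of_convex_of_isClosed
    (fun b => {f : Lp ℝ 2 (gaussianReal 0 1) | gShiftRisk f b ≤ a b})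
    (fun b => convex_gShiftRisk_le b (a b)) (fun b => isClosed_gShiftRisk_le b (a b)) 0
    (by
      refine isBounded_iff_forall_norm_le.2 ⟨(a 0 ^ (1 / 2 : ℝ)).toReal, fun f hf => ?_⟩
      rw [Lp.norm_def, eLpNorm_two_eq_gShiftRisk_zero]
      refine ENNReal.toReal_mono (ENNReal.rpow_ne_top_of_nonneg (by norm_num) ha) ?_
      exact ENNReal.rpow_le_rpow hf (by norm_num))
    (by
      intro F
      obtain ⟨δ, hδ, hF⟩ := h (insert 0 F)
      have hmem : MemLp δ 2 (gaussianReal 0 1) := by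
        refine ⟨hδ.aestronglyMeasurable, ?_⟩
        rw [eLpNorm_two_eq_gShiftRisk_zero]
        exact ENNReal.rpow_lt_top_of_nonneg (by norm_num)
          (ne_top_of_le_ne_top ha (hF 0 (Finset.mem_insert_self _ _)))
      refine ⟨hmem.toLp δ, Set.mem_iInter₂.2 fun b hb => ?_⟩
      rw [Set.mem_ofPred_eq, gShiftRisk_congr_s3 hmem.coeFn_toLp]
      exact hF b (Finset.mem_insert_of_mem hb))
  exact ⟨f, (Lp.stronglyMeasurable f).measurable, Set.mem_iInter.1 hf⟩

theorem rBNM_zero : rBNM 0 = 0 := by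
  refine le_antisymm ((iInf_le _ ⟨fun _ => 0, measurable_const⟩).trans ?_) zero_le
  refine iSup₂_le fun μ hμ => ?_
  obtain rfl : μ = 0 := by simpa using hμ
  simp [gShiftRisk]

/-- The finite minimax principle for the risk shifted by `κ` and rescaled by weights. -/
theorem exists_weights_gShiftRisk (κ : ℝ≥0∞) (hκ : κ ≠ ⊤) (w : ℝ → ℝ≥0∞) (hw : ∀ b, w b ≠ 0)
    (F : Finset ℝ) (c : ℝ)
    (hc : ∀ δ : {f : ℝ → ℝ // Measurable f}, ∃ b : F,
      ENNReal.ofReal c < (gShiftRisk δ b + κ) / w b) :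
    ∃ p : F → ℝ≥0∞, ∑ b, p b = 1 ∧ ∀ δ : {f : ℝ → ℝ // Measurable f},
      ENNReal.ofReal c ≤ ∑ b : F, p b * ((gShiftRisk δ b + κ) / w b) := by
  have : Nonempty {f : ℝ → ℝ // Measurable f} := ⟨⟨fun _ => 0, measurable_const⟩⟩
  refine exists_weights_of_forall_exists_lt
    (fun (δ : {f : ℝ → ℝ // Measurable f}) (b : F) => (gShiftRisk δ b + κ) / w b) ?_ ?_ c hc
  · rintro ⟨δ, hδ⟩ ⟨δ', hδ'⟩ s t hs ht hst
    refine ⟨⟨fun x => s * δ x + t * δ' x, by fun_prop⟩, fun b => ?_⟩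
    have hst' : ENNReal.ofReal s + ENNReal.ofReal t = 1 := by
      rw [← ENNReal.ofReal_add hs ht, hst, ENNReal.ofReal_one]
    simp only [div_eq_mul_inv]
    calc _ ≤ (ENNReal.ofReal s * gShiftRisk δ b + ENNReal.ofReal t * gShiftRisk δ' b
            + (ENNReal.ofReal s + ENNReal.ofReal t) * κ) * (w b)⁻¹ := by
          rw [hst', one_mul]
          gcongr
          exact gShiftRisk_convex hδ hδ' hs ht hst b
      _ = _ := by ring
  · rintro ⟨δ, hδ⟩
    obtain ⟨M, hM⟩ := (F.image fun b => |b|).bddAbove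
    have hclip := fun b : F => gShiftRisk_clip (δ := δ) (hM (Finset.mem_image_of_mem _ b.2))
    refine ⟨⟨fun x => max (-M) (min M (δ x)), by fun_prop⟩, fun b => ⟨?_, ?_⟩⟩
    · gcongr
      exact (hclip b).1
    · exact ENNReal.div_ne_top (ENNReal.add_ne_top.2 ⟨(hclip b).2, hκ⟩) (hw b)

/-- Minimax theorem for the risk shifted by `κ` and rescaled by arbitrary weights. -/
theorem minimax_gShiftRisk (κ : ℝ≥0∞) (hκ : κ ≠ ⊤) (w : ℝ → ℝ≥0∞) (hw : ∀ b, w b ≠ 0)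
    (hw0 : w 0 ≠ ⊤) :
    (⨅ δ : {f : ℝ → ℝ // Measurable f}, ⨆ b : ℝ, (gShiftRisk δ b + κ) / w b)
      = ⨆ π : ProbabilityMeasure ℝ, ⨅ δ : {f : ℝ → ℝ // Measurable f},
          ∫⁻ b, (gShiftRisk δ b + κ) / w b ∂(π : Measure ℝ) := by
  apply le_antisymm
  · refine le_of_forall_gt_imp_ge_of_dense fun c hc => ?_
    obtain rfl | hctop := eq_or_ne c ⊤
    · exact le_top
    have hc0 : c ≠ 0 := (zero_le.trans_lt hc).ne'
    have hle : ∀ δ b, (gShiftRisk δ b + κ) / w b ≤ c ↔ gShiftRisk δ b + κ ≤ c * w b := fun δ b =>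
      ENNReal.div_le_iff_le_mul (Or.inl (hw b)) (Or.inr hc0)
    have hfinite : ∀ F : Finset ℝ, ∃ δ : ℝ → ℝ, Measurable δ ∧
        ∀ b ∈ F, gShiftRisk δ b + κ ≤ c * w b := by
      intro F
      by_contra! hF
      obtain ⟨p, hp, hpc⟩ := exists_weights_gShiftRisk κ hκ w hw F c.toReal fun δ => by
        obtain ⟨b, hb, h⟩ := hF δ δ.2
        refine ⟨⟨b, hb⟩, ?_⟩
        rw [ENNReal.ofReal_toReal hctop]
        exact lt_of_not_ge fun h' => h.not_ge ((hle _ _).1 h')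
      rw [ENNReal.ofReal_toReal hctop] at hpc
      let π : Measure ℝ := ∑ b : F, p b • Measure.dirac (b : ℝ)
      have hπ : IsProbabilityMeasure π := ⟨by simpa [π] using hp⟩
      refine hc.not_ge (le_iSup_of_le ⟨π, hπ⟩ (le_iInf fun δ => (hpc δ).trans_eq ?_))
      simp [π, lintegral_finsetSum_measure]
    obtain ⟨δ, hδ, hδc⟩ := exists_forall_gShiftRisk_le_s3 (fun b => c * w b - κ)
      (ENNReal.sub_ne_top (ENNReal.mul_ne_top hctop hw0)) fun F => by
        obtain ⟨δ, hδ, h⟩ := hfinite F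
        exact ⟨δ, hδ, fun b hb => ENNReal.le_sub_of_add_le_right hκ (h b hb)⟩
    refine iInf_le_of_le ⟨δ, hδ⟩ (iSup_le fun b => (hle δ b).2 ?_)
    obtain ⟨δ', -, h'⟩ := hfinite {b}
    have hκc : κ ≤ c * w b := le_add_self.trans (h' b (Finset.mem_singleton_self b))
    exact (add_le_add_left (hδc b) κ).trans_eq (tsub_add_cancel_of_le hκc)
  · refine iSup_le fun π => iInf_mono fun δ => ?_
    calc _ ≤ ∫⁻ _, ⨆ b, (gShiftRisk δ b + κ) / w b ∂(π : Measure ℝ) :=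
          lintegral_mono fun b => le_iSup (fun b => (gShiftRisk δ b + κ) / w b) b
      _ = _ := by simp

/-- **A minimax theorem for the adaptation objective.**  For every `ρ ∈ (−1,1)`, `ρ ≠ 0`,
the infimum over measurable `δ̃ : ℝ → ℝ` of
`sup_{b̃} (r(δ̃, b̃) + ρ⁻² − 1)/(r^BNM(|b̃|) + ρ⁻² − 1)` equals the supremum over Borel
probability measures `π` on `ℝ` of the infimum over measurable `δ̃` of the `π`-integral of
the same ratio. -/
theorem stmt_3 (ρ : ℝ) (hρ : ρ ∈ Set.Ioo (-1 : ℝ) 1) (hρ0 : ρ ≠ 0) :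
    (⨅ δ : {f : ℝ → ℝ // Measurable f}, ⨆ b : ℝ,
        (gShiftRisk δ b + ENNReal.ofReal ((ρ ^ 2)⁻¹ - 1)) /
          (rBNM |b| + ENNReal.ofReal ((ρ ^ 2)⁻¹ - 1)))
      = ⨆ π : ProbabilityMeasure ℝ,
          ⨅ δ : {f : ℝ → ℝ // Measurable f},
            ∫⁻ b, (gShiftRisk δ b + ENNReal.ofReal ((ρ ^ 2)⁻¹ - 1)) /
              (rBNM |b| + ENNReal.ofReal ((ρ ^ 2)⁻¹ - 1)) ∂(π : Measure ℝ) := by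
  have hρ2 : 1 < (ρ ^ 2)⁻¹ :=
    (one_lt_inv₀ (by positivity)).2 ((sq_lt_one_iff_abs_lt_one ρ).2 (abs_lt.2 hρ))
  refine minimax_gShiftRisk _ ENNReal.ofReal_ne_top _ (fun b => ?_) ?_
  · exact (ENNReal.ofReal_pos.2 (sub_pos.2 hρ2)).trans_le le_add_self |>.ne'
  · simp [rBNM_zero]
end

section
/- As |ρ| → 1 (with ρ ∈ (−1, 1), ρ ≠ 0), limsup A*_S(ρ)/(2 log((ρ^{−2}−1)^{−1})) ≤ 1 and limsup A*_H(ρ)/(2 log((ρ^{−2}−1)^{−1})) ≤ 1; in particular, since A*(ρ) ≤ min{A*_S(ρ), A*_H(ρ)}, also limsup A*(ρ)/(2 log((ρ^{−2}−1)^{−1})) ≤ 1. -/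
open MeasureTheory ProbabilityTheory Filter
open scoped ENNReal Topology

/-- Soft-thresholding estimator `δ_{S,λ}(t) = sign(t)·max{|t| − λ, 0}`. -/
noncomputable def softThresh (l t : ℝ) : ℝ := Real.sign t * max (|t| - l) 0

/-- Hard-thresholding estimator `δ_{H,λ}(t) = t·1{|t| > λ}`. -/
noncomputable def hardThresh (l t : ℝ) : ℝ := if l < |t| then t else 0

/-- Loss of efficiency under adaptation `A*(ρ) = inf_{δ̃ measurable} A(δ̃, ρ)`. -/
noncomputable def Astar (ρ : ℝ) : ℝ≥0∞ :=
  ⨅ δ : {f : ℝ → ℝ // Measurable f}, adaptObj ρ δ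

/-- Minimal worst-case adaptation regret over soft-thresholding estimators. -/
noncomputable def AstarS (ρ : ℝ) : ℝ≥0∞ :=
  ⨅ l ∈ Set.Ici (0 : ℝ), adaptObj ρ (softThresh l)

/-- Minimal worst-case adaptation regret over hard-thresholding estimators. -/
noncomputable def AstarH (ρ : ℝ) : ℝ≥0∞ :=
  ⨅ l ∈ Set.Ici (0 : ℝ), adaptObj ρ (hardThresh l)

/-- The normalization `2·log((ρ⁻² − 1)⁻¹)`, as an extended nonnegative real. -/
noncomputable def denomLog (ρ : ℝ) : ℝ≥0∞ :=
  ENNReal.ofReal (2 * Real.log (((ρ ^ 2)⁻¹ - 1)⁻¹))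

/-- The filter of `ρ` with `|ρ| → 1` from below (eventually `ρ ∈ (−1,1)` and `ρ ≠ 0`). -/
noncomputable def rhoFilter : Filter ℝ :=
  Filter.comap (fun ρ : ℝ => |ρ|) (𝓝[<] (1 : ℝ))

/-- Cauchy–Schwarz for square-integrable functions, with bounds in place of norms. -/
lemma integral_mul_le_of_sq_le {Ω : Type*} [MeasurableSpace Ω] {P : Measure Ω} {f g : Ω → ℝ}
    {V D : ℝ} (hV : 0 < V) (hD : 0 < D) (hf : MemLp f 2 P) (hg : MemLp g 2 P)
    (hfV : ∫ x, f x ^ 2 ∂P ≤ V ^ 2) (hgD : ∫ x, g x ^ 2 ∂P ≤ D ^ 2) :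
    ∫ x, f x * g x ∂P ≤ V * D := by
  calc ∫ x, f x * g x ∂P
      ≤ ∫ x, (D / (2 * V) * f x ^ 2 + V / (2 * D) * g x ^ 2) ∂P := by
        refine integral_mono (hf.integrable_mul hg)
          ((hf.integrable_sq.const_mul _).add (hg.integrable_sq.const_mul _)) fun x => ?_
        have h : D / (2 * V) * f x ^ 2 + V / (2 * D) * g x ^ 2 - f x * g x
            = (D * f x - V * g x) ^ 2 / (2 * V * D) := by
          field_simp
          ring
        have : 0 ≤ (D * f x - V * g x) ^ 2 / (2 * V * D) := by positivity
        simp only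
        linarith
    _ = D / (2 * V) * ∫ x, f x ^ 2 ∂P + V / (2 * D) * ∫ x, g x ^ 2 ∂P := by
        rw [integral_add (hf.integrable_sq.const_mul _) (hg.integrable_sq.const_mul _),
          integral_const_mul, integral_const_mul]
    _ ≤ D / (2 * V) * V ^ 2 + V / (2 * D) * D ^ 2 := by gcongr
    _ = V * D := by
        field_simp
        ring

/-- A risk bound by `V ^ 2` gives square-integrability of the error and a bound on its
second moment. -/
lemma memLp_of_gShiftRisk_le {δ : ℝ → ℝ} (hδ : Measurable δ) {μ V : ℝ}
    (h : gShiftRisk δ μ ≤ ENNReal.ofReal (V ^ 2)) :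
    MemLp (fun t => δ t - μ) 2 (gaussianReal μ 1) ∧
      ∫ t, (δ t - μ) ^ 2 ∂(gaussianReal μ 1) ≤ V ^ 2 := by
  have hm : Measurable fun t => δ t - μ := hδ.sub_const μ
  constructor
  · rw [memLp_two_iff_integrable_sq hm.aestronglyMeasurable]
    refine ⟨(hm.pow_const 2).aestronglyMeasurable, ?_⟩
    rw [hasFiniteIntegral_iff_ofReal (ae_of_all _ fun t => sq_nonneg _)]
    exact h.trans_lt ENNReal.ofReal_lt_top
  · rw [integral_eq_lintegral_of_nonneg_ae (ae_of_all _ fun t => sq_nonneg _)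
      (hm.pow_const 2).aestronglyMeasurable]
    exact ENNReal.toReal_le_of_le_ofReal (sq_nonneg V) h

lemma integrable_of_gShiftRisk_le {δ : ℝ → ℝ} (hδ : Measurable δ) {μ V : ℝ}
    (h : gShiftRisk δ μ ≤ ENNReal.ofReal (V ^ 2)) : Integrable δ (gaussianReal μ 1) := by
  have := ((memLp_of_gShiftRisk_le hδ h).1.integrable one_le_two).add (integrable_const μ)
  exact this.congr (ae_of_all _ fun t => by simp)

/-- Likelihood ratio of `N(μ + h, 1)` with respect to `N(μ, 1)`. -/
noncomputable def gaussianRatio (μ h x : ℝ) : ℝ := Real.exp (h * (x - μ) - h ^ 2 / 2)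

lemma integral_gaussianReal_add (μ h : ℝ) (f : ℝ → ℝ) :
    ∫ x, f x ∂(gaussianReal (μ + h) 1)
      = ∫ x, f x * gaussianRatio μ h x ∂(gaussianReal μ 1) := by
  rw [integral_gaussianReal_eq_integral_smul one_ne_zero,
    integral_gaussianReal_eq_integral_smul one_ne_zero]
  refine integral_congr_ae (ae_of_all _ fun x => ?_)
  have : gaussianPDFReal (μ + h) 1 x = gaussianPDFReal μ 1 x * gaussianRatio μ h x := by
    simp only [gaussianPDFReal, gaussianRatio]
    rw [mul_assoc (√_)⁻¹, ← Real.exp_add]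
    congr 2
    simp
    ring
  simp only [this, smul_eq_mul]
  ring

lemma integral_gaussianRatio (μ h : ℝ) :
    ∫ x, gaussianRatio μ h x ∂(gaussianReal μ 1) = 1 := by
  simpa using (integral_gaussianReal_add μ h fun _ => 1).symm

lemma gaussianRatio_sq (μ h x : ℝ) :
    gaussianRatio μ h x ^ 2 = Real.exp (h ^ 2) * gaussianRatio μ (2 * h) x := by
  simp only [gaussianRatio]
  rw [← Real.exp_nat_mul, ← Real.exp_add]
  congr 1
  push_cast
  ring

lemma memLp_gaussianRatio (μ h : ℝ) :
    MemLp (gaussianRatio μ h) 2 (gaussianReal μ 1) := by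
  have hm : Measurable (gaussianRatio μ h) := by
    unfold gaussianRatio
    fun_prop
  rw [memLp_two_iff_integrable_sq hm.aestronglyMeasurable]
  simp_rw [gaussianRatio_sq]
  refine (Integrable.of_integral_ne_zero ?_).const_mul _
  rw [integral_gaussianRatio]
  exact one_ne_zero

/-- The chi-square divergence of `N(μ + h, 1)` from `N(μ, 1)`. -/
lemma integral_gaussianRatio_sub_one_sq (μ h : ℝ) :
    ∫ x, (gaussianRatio μ h x - 1) ^ 2 ∂(gaussianReal μ 1) = Real.exp (h ^ 2) - 1 := by
  have hL := memLp_gaussianRatio μ h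
  have hi : Integrable (gaussianRatio μ h) (gaussianReal μ 1) := hL.integrable one_le_two
  have : ∀ x, (gaussianRatio μ h x - 1) ^ 2
      = gaussianRatio μ h x ^ 2 - (2 * gaussianRatio μ h x - 1) := fun x => by ring
  simp_rw [this]
  have hi' : Integrable (fun x => 2 * gaussianRatio μ h x - 1) (gaussianReal μ 1) :=
    (hi.const_mul 2).sub (integrable_const 1)
  rw [integral_sub hL.integrable_sq hi', integral_sub (hi.const_mul 2) (integrable_const 1),
    integral_const_mul, integral_gaussianRatio]
  simp_rw [gaussianRatio_sq]
  rw [integral_const_mul, integral_gaussianRatio]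
  simp
  ring

/-- Bounded risk forces the mean of an estimator to grow slowly (Chapman–Robbins). -/
lemma integral_add_sub_integral_le {δ : ℝ → ℝ} (hδ : Measurable δ) {μ h V : ℝ} (hV : 0 < V)
    (hh : 0 < h) (h₁ : gShiftRisk δ μ ≤ ENNReal.ofReal (V ^ 2))
    (h₂ : gShiftRisk δ (μ + h) ≤ ENNReal.ofReal (V ^ 2)) :
    ∫ t, δ t ∂(gaussianReal (μ + h) 1) - ∫ t, δ t ∂(gaussianReal μ 1)
      ≤ V * (h * Real.exp (h ^ 2 / 2)) := by
  obtain ⟨hm₁, hi₁⟩ := memLp_of_gShiftRisk_le hδ h₁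
  have hδμ : Integrable (fun t => δ t - μ) (gaussianReal μ 1) := hm₁.integrable one_le_two
  have hδ₁ := integrable_of_gShiftRisk_le hδ h₁
  have hδ₂ := integrable_of_gShiftRisk_le hδ h₂
  have hL := memLp_gaussianRatio μ h
  have e₁ : ∫ t, δ t ∂(gaussianReal μ 1) - μ = ∫ t, (δ t - μ) ∂(gaussianReal μ 1) := by
    rw [integral_sub hδ₁ (integrable_const μ)]
    simp
  have e₂ : ∫ t, δ t ∂(gaussianReal (μ + h) 1) - μ
      = ∫ t, (δ t - μ) * gaussianRatio μ h t ∂(gaussianReal μ 1) := by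
    rw [← integral_gaussianReal_add μ h fun t => δ t - μ,
      integral_sub hδ₂ (integrable_const μ)]
    simp
  have e₃ : ∫ t, δ t ∂(gaussianReal (μ + h) 1) - ∫ t, δ t ∂(gaussianReal μ 1)
      = ∫ t, (δ t - μ) * (gaussianRatio μ h t - 1) ∂(gaussianReal μ 1) := by
    simp_rw [mul_sub, mul_one]
    have hmul : Integrable (fun t => (δ t - μ) * gaussianRatio μ h t) (gaussianReal μ 1) :=
      hm₁.integrable_mul hL
    rw [integral_sub hmul hδμ, ← e₁, ← e₂]
    ring
  rw [e₃]
  refine integral_mul_le_of_sq_le hV (by positivity) hm₁ (hL.sub (memLp_const 1)) hi₁ ?_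
  rw [integral_gaussianRatio_sub_one_sq]
  have h₃ : 1 - h ^ 2 ≤ Real.exp (-h ^ 2) := by
    have := Real.add_one_le_exp (-h ^ 2)
    linarith
  have h₄ : Real.exp (-h ^ 2) * Real.exp (h ^ 2) = 1 := by
    rw [← Real.exp_add]
    simp
  have h₅ : (h * Real.exp (h ^ 2 / 2)) ^ 2 = h ^ 2 * Real.exp (h ^ 2) := by
    rw [mul_pow, ← Real.exp_nat_mul]
    congr 2
    push_cast
    ring
  rw [h₅]
  nlinarith [mul_le_mul_of_nonneg_right h₃ (Real.exp_pos (h ^ 2)).le]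

/-- The bias of an estimator is bounded by its root risk. -/
lemma abs_integral_sub_le {δ : ℝ → ℝ} (hδ : Measurable δ) {μ V : ℝ} (hV : 0 < V)
    (h : gShiftRisk δ μ ≤ ENNReal.ofReal (V ^ 2)) :
    |∫ t, δ t ∂(gaussianReal μ 1) - μ| ≤ V := by
  obtain ⟨hm, hi⟩ := memLp_of_gShiftRisk_le hδ h
  have hδi := integrable_of_gShiftRisk_le hδ h
  have e : ∫ t, δ t ∂(gaussianReal μ 1) - μ = ∫ t, (δ t - μ) ∂(gaussianReal μ 1) := by
    rw [integral_sub hδi (integrable_const μ)]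
    simp
  have key : ∀ c : ℝ, c ^ 2 = 1 → c * ∫ t, (δ t - μ) ∂(gaussianReal μ 1) ≤ V := by
    intro c hc
    have := integral_mul_le_of_sq_le (g := fun _ => c) hV one_pos hm (memLp_const c) hi
      (by simp [hc])
    rw [integral_mul_const] at this
    linarith
  rw [e, abs_le]
  constructor
  · linarith [key (-1) (by norm_num)]
  · linarith [key 1 (by norm_num)]

lemma le_mul_one_add_of_gShiftRisk_le {δ : ℝ → ℝ} (hδ : Measurable δ) {τ V : ℝ} (hV : 0 < V)
    (hτ : 0 < τ)
    (h : ∀ μ ∈ Set.Icc (-τ) τ, gShiftRisk δ μ ≤ ENNReal.ofReal (V ^ 2)) :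
    τ ≤ V * (1 + τ) := by
  set m : ℝ → ℝ := fun μ => ∫ t, δ t ∂(gaussianReal μ 1) with hm
  have step : ∀ n : ℕ, 0 < n →
      τ ≤ V * (1 + τ * Real.exp ((2 * τ / n) ^ 2 / 2)) := by
    intro n hn
    have hn' : (0 : ℝ) < n := by exact_mod_cast hn
    set s : ℝ := 2 * τ / n with hs
    have hs0 : 0 < s := by positivity
    have hns : n * s = 2 * τ := by rw [hs]; field_simp
    have hmem : ∀ k : ℕ, k ≤ n → -τ + k * s ∈ Set.Icc (-τ) τ := by
      intro k hk
      have hk' : (k : ℝ) ≤ n := by exact_mod_cast hk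
      have : (k : ℝ) * s ≤ n * s := by gcongr
      have : 0 ≤ (k : ℝ) * s := by positivity
      constructor <;> linarith
    have hind : ∀ k : ℕ, k ≤ n →
        m (-τ + k * s) - m (-τ) ≤ k * (V * (s * Real.exp (s ^ 2 / 2))) := by
      intro k
      induction k with
      | zero => simp
      | succ k ih =>
        intro hk
        have e : -τ + ((k + 1 : ℕ) : ℝ) * s = (-τ + k * s) + s := by
          push_cast
          ring
        have h₁ := ih (by omega)
        have h₂ := integral_add_sub_integral_le hδ hV hs0 (h _ (hmem k (by omega)))
          (e ▸ h _ (hmem (k + 1) hk))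
        rw [e]
        push_cast
        simp only [hm] at h₁ ⊢
        linarith
    have h₁ := hind n le_rfl
    have e : -τ + n * s = τ := by linarith
    rw [e] at h₁
    have h₂ := abs_le.1 (abs_integral_sub_le hδ hV (h τ ⟨by linarith, le_rfl⟩))
    have h₃ := abs_le.1 (abs_integral_sub_le hδ hV (h (-τ) ⟨le_rfl, by linarith⟩))
    have h₄ : n * (V * (s * Real.exp (s ^ 2 / 2))) = 2 * τ * V * Real.exp (s ^ 2 / 2) := by
      rw [← hns]
      ring
    simp only [hm] at h₁
    nlinarith [h₂.1, h₃.2]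
  have hlim : Tendsto (fun n : ℕ => V * (1 + τ * Real.exp ((2 * τ / (n : ℝ)) ^ 2 / 2))) atTop
      (𝓝 (V * (1 + τ * Real.exp ((0 : ℝ) ^ 2 / 2)))) :=
    ((((tendsto_const_div_atTop_nhds_zero_nat (2 * τ)).pow 2).div_const 2).rexp.const_mul
      τ).const_add 1 |>.const_mul V
  have := ge_of_tendsto hlim (eventually_atTop.2 ⟨1, fun n hn => step n hn⟩)
  simpa using this

/-- Lower bound on the bounded normal mean minimax risk. -/
lemma sq_div_le_rBNM {τ : ℝ} (hτ : 0 ≤ τ) : ENNReal.ofReal ((τ / (1 + τ)) ^ 2) ≤ rBNM τ := by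
  rcases hτ.eq_or_lt with rfl | hτ
  · simp
  refine le_iInf fun δ => ?_
  by_contra! hlt
  obtain ⟨c, hc₁, hc₂⟩ := exists_between hlt
  have hc0 : 0 < c := lt_of_le_of_lt zero_le hc₁
  have hct : c ≠ ⊤ := (hc₂.trans ENNReal.ofReal_lt_top).ne
  have hcp : 0 < c.toReal := ENNReal.toReal_pos hc0.ne' hct
  have hsq : √c.toReal ^ 2 = c.toReal := Real.sq_sqrt hcp.le
  have hle : τ ≤ √c.toReal * (1 + τ) := by
    refine le_mul_one_add_of_gShiftRisk_le δ.2 (Real.sqrt_pos.2 hcp) hτ fun μ hμ => ?_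
    rw [hsq, ENNReal.ofReal_toReal hct]
    exact (le_iSup₂ (f := fun μ (_ : μ ∈ Set.Icc (-τ) τ) => gShiftRisk δ μ) μ hμ).trans hc₁.le
  have h₁ : τ / (1 + τ) ≤ √c.toReal := (div_le_iff₀ (by positivity)).2 hle
  have h₂ : (τ / (1 + τ)) ^ 2 ≤ c.toReal := hsq ▸ by gcongr
  rw [← ENNReal.ofReal_toReal hct] at hc₂
  exact absurd hc₂ (ENNReal.ofReal_le_ofReal h₂).not_gt

lemma rBNM_mono {a b : ℝ} (h : a ≤ b) : rBNM a ≤ rBNM b :=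
  iInf_mono fun _ => biSup_mono fun _ hμ => Set.Icc_subset_Icc (neg_le_neg h) h hμ

/-- Rules that kill observations in `[-l, l]` and move the others by at most `l`. -/
structure IsThresholdRule (l : ℝ) (δ : ℝ → ℝ) : Prop where
  abs_sub_le : ∀ t, |δ t - t| ≤ l
  eq_zero : ∀ t, |t| ≤ l → δ t = 0

lemma isThresholdRule_hardThresh {l : ℝ} (hl : 0 ≤ l) : IsThresholdRule l (hardThresh l) where
  abs_sub_le t := by
    unfold hardThresh
    split_ifs with h
    · simpa using hl
    · simpa using h
  eq_zero t ht := by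
    unfold hardThresh
    rw [if_neg ht.not_gt]

lemma isThresholdRule_softThresh {l : ℝ} (hl : 0 ≤ l) : IsThresholdRule l (softThresh l) where
  abs_sub_le t := by
    unfold softThresh
    rcases lt_trichotomy t 0 with h | rfl | h
    · rw [Real.sign_of_neg h, abs_of_neg h, abs_le]
      rcases max_cases (-t - l) 0 with ⟨h₁, h₂⟩ | ⟨h₁, h₂⟩ <;> rw [h₁] <;>
        constructor <;> linarith
    · simpa using hl
    · rw [Real.sign_of_pos h, abs_of_pos h, abs_le]
      rcases max_cases (t - l) 0 with ⟨h₁, h₂⟩ | ⟨h₁, h₂⟩ <;> rw [h₁] <;>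
        constructor <;> linarith
  eq_zero t ht := by
    unfold softThresh
    rw [max_eq_right (by linarith), mul_zero]

lemma measurable_hardThresh (l : ℝ) : Measurable (hardThresh l) :=
  Measurable.ite (measurableSet_lt measurable_const measurable_id.abs) measurable_id
    measurable_const

lemma measurable_softThresh (l : ℝ) : Measurable (softThresh l) := by
  have hs : Measurable Real.sign :=
    Measurable.ite measurableSet_Iio measurable_const
      (Measurable.ite measurableSet_Ioi measurable_const measurable_const)
  unfold softThresh
  fun_prop

/-- Bounding the risk by integrating a pointwise bound on the squared error. -/
lemma gShiftRisk_le_integral {δ g : ℝ → ℝ} {b : ℝ} (hg : Measurable g)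
    (hgi : Integrable g (gaussianReal 0 1)) (h : ∀ t, (δ t - b) ^ 2 ≤ g (t - b)) :
    gShiftRisk δ b ≤ ENNReal.ofReal (∫ z, g z ∂(gaussianReal 0 1)) := by
  have h0 : ∀ z, 0 ≤ g z := fun z => by
    have := h (z + b)
    rw [add_sub_cancel_right] at this
    exact (sq_nonneg _).trans this
  have hmap : (gaussianReal b 1).map (fun t => t - b) = gaussianReal 0 1 := by
    rw [gaussianReal_map_sub_const, sub_self]
  calc gShiftRisk δ b ≤ ∫⁻ t, ENNReal.ofReal (g (t - b)) ∂(gaussianReal b 1) :=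
        lintegral_mono fun t => ENNReal.ofReal_le_ofReal (h t)
    _ = ∫⁻ z, ENNReal.ofReal (g z) ∂(gaussianReal 0 1) := by
        rw [← hmap, lintegral_map hg.ennreal_ofReal (by fun_prop)]
    _ = ENNReal.ofReal (∫ z, g z ∂(gaussianReal 0 1)) :=
        (ofReal_integral_eq_lintegral_ofReal hgi (ae_of_all _ h0)).symm

lemma integrable_sq_gaussianReal : Integrable (fun z : ℝ => z ^ 2) (gaussianReal 0 1) :=
  (memLp_id_gaussianReal 2).integrable_sq

lemma integral_sq_gaussianReal : ∫ z, z ^ 2 ∂(gaussianReal 0 1) = 1 := by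
  have h := variance_fun_id_gaussianReal (μ := 0) (v := 1)
  rw [variance_eq_integral (by fun_prop)] at h
  simpa using h

lemma integrable_sq_mul_exp_gaussianReal {s : ℝ} (hs : s < 1 / 2) :
    Integrable (fun z : ℝ => z ^ 2 * Real.exp (s * z ^ 2)) (gaussianReal 0 1) := by
  rw [gaussianReal_of_var_ne_zero 0 one_ne_zero,
    integrable_withDensity_iff (measurable_gaussianPDF 0 1)
      (ae_of_all _ fun _ => gaussianPDF_lt_top)]
  have h := (integrable_rpow_mul_exp_neg_mul_sq (b := 1 / 2 - s) (by linarith)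
    (s := 2) (by norm_num)).mul_const (√(2 * Real.pi))⁻¹
  refine h.congr (ae_of_all _ fun z => ?_)
  simp only [toReal_gaussianPDF, gaussianPDFReal]
  have e : Real.exp (-(1 / 2 - s) * z ^ 2) = Real.exp (s * z ^ 2) * Real.exp (-z ^ 2 / 2) := by
    rw [← Real.exp_add]
    congr 1
    ring
  rw [e]
  norm_num
  ring

/-- The exponentially tilted second moment of the standard normal law. -/
noncomputable def tiltedSecondMoment (s : ℝ) : ℝ :=
  ∫ z, z ^ 2 * Real.exp (s * z ^ 2) ∂(gaussianReal 0 1)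

lemma tiltedSecondMoment_nonneg (s : ℝ) : 0 ≤ tiltedSecondMoment s :=
  integral_nonneg fun z => by positivity

lemma IsThresholdRule.gShiftRisk_le {l θ b : ℝ} {δ : ℝ → ℝ} (hδ : IsThresholdRule l δ)
    (hθ : 0 < θ) :
    gShiftRisk δ b ≤ ENNReal.ofReal ((1 + θ) * l ^ 2 + (1 + 1 / θ)) := by
  have h := gShiftRisk_le_integral (δ := δ) (b := b)
    (g := fun z => (1 + θ) * l ^ 2 + (1 + 1 / θ) * z ^ 2) (by fun_prop)
    ((integrable_const _).add (integrable_sq_gaussianReal.const_mul _)) fun t => ?_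
  · rwa [integral_add (integrable_const _) (integrable_sq_gaussianReal.const_mul _),
      integral_const, probReal_univ, one_smul, integral_const_mul, integral_sq_gaussianReal,
      mul_one] at h
  · have h₁ : (δ t - t) ^ 2 ≤ l ^ 2 := sq_le_sq' (abs_le.1 (hδ.abs_sub_le t)).1
      (abs_le.1 (hδ.abs_sub_le t)).2
    have h₂ : (1 + θ) * (δ t - t) ^ 2 + (1 + 1 / θ) * (t - b) ^ 2 - (δ t - b) ^ 2
        = (θ * (δ t - t) - (t - b)) ^ 2 / θ := by
      field_simp
      ring
    have h₃ : 0 ≤ (θ * (δ t - t) - (t - b)) ^ 2 / θ := by positivity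
    nlinarith

lemma IsThresholdRule.gShiftRisk_le_tilted {l s b : ℝ} {δ : ℝ → ℝ} (hδ : IsThresholdRule l δ)
    (hs0 : 0 ≤ s) (hs : s < 1 / 2) (hb : |b| ≤ l) :
    gShiftRisk δ b ≤ ENNReal.ofReal
      (2 * b ^ 2 + 8 * Real.exp (-(s * (l - |b|) ^ 2)) * tiltedSecondMoment s) := by
  have hi := integrable_sq_mul_exp_gaussianReal hs
  have h := gShiftRisk_le_integral (δ := δ) (b := b)
    (g := fun z => 2 * b ^ 2 + 8 * Real.exp (-(s * (l - |b|) ^ 2)) *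
      (z ^ 2 * Real.exp (s * z ^ 2))) (by fun_prop)
    ((integrable_const _).add (hi.const_mul _)) fun t => ?_
  · rwa [integral_add (integrable_const _) (hi.const_mul _),
      integral_const, probReal_univ, one_smul, integral_const_mul] at h
  · by_cases ht : |t| ≤ l
    · rw [hδ.eq_zero t ht, zero_sub, neg_sq]
      have : 0 ≤ 8 * Real.exp (-(s * (l - |b|) ^ 2)) *
        ((t - b) ^ 2 * Real.exp (s * (t - b) ^ 2)) := by positivity
      nlinarith [sq_nonneg b]
    · push Not at ht
      have habs : |t| ≤ |t - b| + |b| := by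
        simpa using abs_add_le (t - b) b
      have h₁ : (l - |b|) ^ 2 ≤ (t - b) ^ 2 := by
        rw [← sq_abs (t - b)]
        exact pow_le_pow_left₀ (by linarith) (by linarith) 2
      have h₂ : |δ t - b| ≤ 2 * |t - b| + |b| := by
        have e : |δ t - b| ≤ |δ t - t| + |t - b| := _root_.abs_sub_le _ _ _
        linarith [hδ.abs_sub_le t]
      have h₃ : (δ t - b) ^ 2 ≤ 2 * b ^ 2 + 8 * (t - b) ^ 2 := by
        rw [← sq_abs (δ t - b), ← sq_abs (t - b), ← sq_abs b]
        nlinarith [abs_nonneg (δ t - b), sq_nonneg (2 * |t - b| - |b|), abs_nonneg b,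
          abs_nonneg (t - b), pow_le_pow_left₀ (abs_nonneg (δ t - b)) h₂ 2]
      have h₄ : 1 ≤ Real.exp (-(s * (l - |b|) ^ 2)) * Real.exp (s * (t - b) ^ 2) := by
        rw [← Real.exp_add]
        refine Real.one_le_exp ?_
        nlinarith [mul_le_mul_of_nonneg_left h₁ hs0]
      nlinarith [mul_le_mul_of_nonneg_left h₄ (sq_nonneg (t - b))]

/-- For large thresholds the risk of every threshold rule is, up to a factor `(1 + θ) ^ 4 * l ^ 2`,
within the adaptation benchmark. -/
lemma eventually_gShiftRisk_add_le {θ : ℝ} (hθ : 0 < θ) :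
    ∀ᶠ l : ℝ in atTop, ∀ δ, IsThresholdRule l δ → ∀ b,
      gShiftRisk δ b + ENNReal.ofReal (Real.exp (-(1 / (2 * (1 + θ)) * l ^ 2)))
        ≤ ENNReal.ofReal ((1 + θ) ^ 4 * l ^ 2) *
          (rBNM |b| + ENNReal.ofReal (Real.exp (-(1 / (2 * (1 + θ)) * l ^ 2)))) := by
  set s : ℝ := 1 / (2 * (1 + θ)) with hs
  have hs0 : 0 < s := by positivity
  have hs1 : s < 1 / 2 := by
    rw [hs]
    apply one_div_lt_one_div_of_lt <;> linarith
  set C := tiltedSecondMoment s with hC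
  have hC0 : 0 ≤ C := tiltedSecondMoment_nonneg s
  set M : ℝ := 1 / θ with hM
  have hM0 : 0 < M := by positivity
  have hsq : Tendsto (fun l : ℝ => l ^ 2) atTop atTop := tendsto_pow_atTop two_ne_zero
  have hsub : Tendsto (fun l : ℝ => l - M) atTop atTop :=
    tendsto_atTop_add_const_right _ _ tendsto_id
  have htail : Tendsto (fun l : ℝ => 8 * Real.exp (-(s * (l - M) ^ 2)) * C) atTop
      (𝓝 (8 * 0 * C)) := by
    refine Tendsto.mul_const _ (Tendsto.const_mul _ ?_)
    exact Real.tendsto_exp_neg_atTop_nhds_zero.comp ((hsq.comp hsub).const_mul_atTop hs0)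
  rw [mul_zero, zero_mul] at htail
  have hpos : 0 < 1 / (2 * (1 + M) ^ 2) := by positivity
  filter_upwards [eventually_ge_atTop 1, eventually_ge_atTop M,
    hsq.eventually_ge_atTop 8, hsq.eventually_ge_atTop (8 * Real.exp 1 * C + 1),
    hsq.eventually_ge_atTop (4 * (1 + M) ^ 2), htail.eventually_le_const hpos,
    hsq.eventually_ge_atTop ((2 + 1 / θ) / ((1 + θ) * θ))]
    with l hl1 hlM hl8 hlC hl4 hlt hlbig δ hδ b
  set ε := Real.exp (-(s * l ^ 2)) with hε
  have hε0 : 0 < ε := Real.exp_pos _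
  have hε1 : ε ≤ 1 := Real.exp_le_one_iff.2 (by simp; positivity)
  have hb0 := abs_nonneg b
  have hbsq : |b| ^ 2 = b ^ 2 := sq_abs b
  have hfac : l ^ 2 ≤ (1 + θ) ^ 4 * l ^ 2 :=
    le_mul_of_one_le_left (sq_nonneg l) (one_le_pow₀ (by linarith))
  have finish : ∀ x y : ℝ, 0 ≤ x → 0 ≤ y → gShiftRisk δ b ≤ ENNReal.ofReal x →
      ENNReal.ofReal y ≤ rBNM |b| → x + ε ≤ (1 + θ) ^ 4 * l ^ 2 * (y + ε) →
      gShiftRisk δ b + ENNReal.ofReal ε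
        ≤ ENNReal.ofReal ((1 + θ) ^ 4 * l ^ 2) * (rBNM |b| + ENNReal.ofReal ε) := by
    intro x y hx hy h₁ h₂ h₃
    calc gShiftRisk δ b + ENNReal.ofReal ε ≤ ENNReal.ofReal x + ENNReal.ofReal ε := by gcongr
      _ = ENNReal.ofReal (x + ε) := (ENNReal.ofReal_add hx hε0.le).symm
      _ ≤ ENNReal.ofReal ((1 + θ) ^ 4 * l ^ 2 * (y + ε)) := ENNReal.ofReal_le_ofReal h₃
      _ = ENNReal.ofReal ((1 + θ) ^ 4 * l ^ 2) * (ENNReal.ofReal y + ENNReal.ofReal ε) := by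
          rw [ENNReal.ofReal_mul (by positivity), ENNReal.ofReal_add hy hε0.le]
      _ ≤ _ := by gcongr
  rcases le_total M |b| with hbM | hbM
  · refine finish _ ((M / (1 + M)) ^ 2) (by positivity) (by positivity)
      (hδ.gShiftRisk_le (b := b) hθ) ((sq_div_le_rBNM hM0.le).trans (rBNM_mono hbM)) ?_
    have e : M / (1 + M) = 1 / (1 + θ) := by
      rw [hM]
      field_simp
      ring
    have e' : (1 + θ) ^ 4 * l ^ 2 * (1 / (1 + θ)) ^ 2 = (1 + θ) ^ 2 * l ^ 2 := by
      field_simp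
    rw [e, mul_add, e']
    rw [div_le_iff₀ (by positivity)] at hlbig
    have : 0 ≤ (1 + θ) ^ 4 * l ^ 2 * ε := by positivity
    nlinarith
  · rcases le_total (l * |b|) 1 with hlb | hlb
    · have hb1 : |b| ≤ 1 := by nlinarith
      refine finish _ (b ^ 2 / 4) ?_ (by positivity)
        (hδ.gShiftRisk_le_tilted (b := b) hs0.le hs1 (by linarith))
        (le_trans (ENNReal.ofReal_le_ofReal ?_) (sq_div_le_rBNM hb0)) ?_
      · positivity
      · rw [div_pow, hbsq]
        gcongr
        nlinarith
      · have hexp : Real.exp (-(s * (l - |b|) ^ 2)) ≤ Real.exp 1 * ε := by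
          rw [hε, ← Real.exp_add]
          refine Real.exp_le_exp.2 ?_
          have : s * (l * |b|) ≤ 1 / 2 * 1 := by gcongr
          nlinarith [mul_nonneg hs0.le (sq_nonneg b)]
        have h₁ : 8 * Real.exp (-(s * (l - |b|) ^ 2)) * C ≤ 8 * (Real.exp 1 * ε) * C := by
          gcongr
        have h₂ : (8 * Real.exp 1 * C + 1) * ε ≤ l ^ 2 * ε := by gcongr
        have h₃ : 8 * (b ^ 2 / 4) ≤ l ^ 2 * (b ^ 2 / 4) := by gcongr
        have h₄ : l ^ 2 * (b ^ 2 / 4 + ε) ≤ (1 + θ) ^ 4 * l ^ 2 * (b ^ 2 / 4 + ε) := by gcongr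
        linarith
    · refine finish _ (b ^ 2 / (1 + M) ^ 2) ?_ (by positivity)
        (hδ.gShiftRisk_le_tilted (b := b) hs0.le hs1 (by linarith))
        (le_trans (ENNReal.ofReal_le_ofReal ?_) (sq_div_le_rBNM hb0)) ?_
      · positivity
      · rw [div_pow, hbsq]
        gcongr
      · have h₁ : 8 * Real.exp (-(s * (l - |b|) ^ 2)) * C
            ≤ 8 * Real.exp (-(s * (l - M) ^ 2)) * C := by
          gcongr
        have h₂ : 1 ≤ l ^ 2 * b ^ 2 := by
          rw [← hbsq, ← mul_pow]
          exact one_le_pow₀ hlb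
        have h₃ : 1 / (2 * (1 + M) ^ 2) ≤ l ^ 2 * b ^ 2 / (2 * (1 + M) ^ 2) := by gcongr
        have h₄ : 2 * b ^ 2 ≤ l ^ 2 * b ^ 2 / (2 * (1 + M) ^ 2) := by
          rw [le_div_iff₀ (by positivity)]
          nlinarith [sq_nonneg b]
        have h₅ : l ^ 2 * (b ^ 2 / (1 + M) ^ 2)
            = l ^ 2 * b ^ 2 / (2 * (1 + M) ^ 2) + l ^ 2 * b ^ 2 / (2 * (1 + M) ^ 2) := by
          field_simp
          ring
        have h₆ : l ^ 2 * (b ^ 2 / (1 + M) ^ 2 + ε)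
            ≤ (1 + θ) ^ 4 * l ^ 2 * (b ^ 2 / (1 + M) ^ 2 + ε) := by gcongr
        have h₇ : 1 * ε ≤ l ^ 2 * ε := by
          gcongr
          linarith
        linarith

lemma tendsto_inv_sq_sub_one_rhoFilter :
    Tendsto (fun ρ : ℝ => (ρ ^ 2)⁻¹ - 1) rhoFilter (𝓝[>] 0) := by
  have habs : Tendsto (fun ρ : ℝ => |ρ|) rhoFilter (𝓝[<] 1) := tendsto_comap
  have h : Tendsto (fun x : ℝ => (x ^ 2)⁻¹ - 1) (𝓝[<] 1) (𝓝[>] 0) := by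
    refine tendsto_nhdsWithin_iff.2 ⟨?_, ?_⟩
    · have hc : ContinuousAt (fun x : ℝ => (x ^ 2)⁻¹ - 1) 1 := by
        fun_prop (disch := norm_num)
      have := hc.tendsto.mono_left (nhdsWithin_le_nhds (s := Set.Iio 1))
      simpa using this
    · filter_upwards [Ioo_mem_nhdsLT (zero_lt_one' ℝ)] with x ⟨hx0, hx1⟩
      have : 1 < (x ^ 2)⁻¹ := (one_lt_inv₀ (by positivity)).2 (by nlinarith)
      simpa using this
  simpa [Function.comp_def] using h.comp habs

/-- Close to `|ρ| = 1`, some threshold makes every threshold rule nearly attain the bound. -/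
lemma eventually_adaptObj_le {θ : ℝ} (hθ : 0 < θ) :
    ∀ᶠ ρ in rhoFilter, ∃ l ∈ Set.Ici (0 : ℝ), ∀ δ, IsThresholdRule l δ →
      adaptObj ρ δ ≤ ENNReal.ofReal ((1 + θ) ^ 5) * denomLog ρ := by
  have hε := tendsto_inv_sq_sub_one_rhoFilter
  have hL : Tendsto (fun ρ : ℝ => Real.log (((ρ ^ 2)⁻¹ - 1)⁻¹)) rhoFilter atTop :=
    Real.tendsto_log_atTop.comp (tendsto_inv_nhdsGT_zero.comp hε)
  have hl : Tendsto (fun ρ : ℝ => √(2 * (1 + θ) * Real.log (((ρ ^ 2)⁻¹ - 1)⁻¹)))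
      rhoFilter atTop :=
    Real.tendsto_sqrt_atTop.comp (hL.const_mul_atTop (by positivity))
  filter_upwards [hl.eventually (eventually_gShiftRisk_add_le hθ), hL.eventually_ge_atTop 0,
    (tendsto_nhdsWithin_iff.1 hε).2] with ρ h hL0 hpos
  refine ⟨√(2 * (1 + θ) * Real.log (((ρ ^ 2)⁻¹ - 1)⁻¹)), Real.sqrt_nonneg _,
    fun δ hδ => iSup_le fun b => ENNReal.div_le_of_le_mul ?_⟩
  have hb := h δ hδ b
  rw [Real.sq_sqrt (by positivity)] at hb
  have e₁ : Real.exp (-(1 / (2 * (1 + θ)) * (2 * (1 + θ) * Real.log (((ρ ^ 2)⁻¹ - 1)⁻¹))))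
      = (ρ ^ 2)⁻¹ - 1 := by
    rw [← mul_assoc, one_div_mul_cancel (by positivity), one_mul, Real.log_inv, neg_neg,
      Real.exp_log hpos]
  have e₂ : (1 + θ) ^ 4 * (2 * (1 + θ) * Real.log (((ρ ^ 2)⁻¹ - 1)⁻¹))
      = (1 + θ) ^ 5 * (2 * Real.log (((ρ ^ 2)⁻¹ - 1)⁻¹)) := by ring
  rwa [e₁, e₂, ENNReal.ofReal_mul (by positivity)] at hb

lemma limsup_div_denomLog_le_one {A : ℝ → ℝ≥0∞}
    (h : ∀ θ : ℝ, 0 < θ → ∀ᶠ ρ in rhoFilter, A ρ ≤ ENNReal.ofReal ((1 + θ) ^ 5) * denomLog ρ) :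
    limsup (fun ρ => A ρ / denomLog ρ) rhoFilter ≤ 1 := by
  have hlim : Tendsto (fun θ : ℝ => ENNReal.ofReal ((1 + θ) ^ 5)) (𝓝[>] 0) (𝓝 1) := by
    have hc : Continuous fun θ : ℝ => ENNReal.ofReal ((1 + θ) ^ 5) :=
      ENNReal.continuous_ofReal.comp (by fun_prop)
    have := (hc.tendsto 0).mono_left (nhdsWithin_le_nhds (s := Set.Ioi 0))
    simpa using this
  refine ge_of_tendsto hlim (eventually_nhdsWithin_of_forall fun θ hθ => ?_)
  refine limsup_le_of_le (h := ?_)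
  filter_upwards [h θ hθ] with ρ hρ
  exact ENNReal.div_le_of_le_mul hρ

/-- **Upper bounds as `|ρ| → 1`.**  The limsups of `A*_S(ρ)/(2 log((ρ⁻²−1)⁻¹))` and
`A*_H(ρ)/(2 log((ρ⁻²−1)⁻¹))` along `|ρ| ↑ 1` are at most `1`; in particular, since
`A*(ρ) ≤ min {A*_S(ρ), A*_H(ρ)}`, the limsup of `A*(ρ)/(2 log((ρ⁻²−1)⁻¹))` is also at
most `1`. -/
theorem stmt_10 :
    (limsup (fun ρ : ℝ => AstarS ρ / denomLog ρ) rhoFilter ≤ 1) ∧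
    (limsup (fun ρ : ℝ => AstarH ρ / denomLog ρ) rhoFilter ≤ 1) ∧
    (∀ ρ : ℝ, Astar ρ ≤ min (AstarS ρ) (AstarH ρ)) ∧
    (limsup (fun ρ : ℝ => Astar ρ / denomLog ρ) rhoFilter ≤ 1) := by
  have hS : limsup (fun ρ : ℝ => AstarS ρ / denomLog ρ) rhoFilter ≤ 1 := by
    refine limsup_div_denomLog_le_one fun θ hθ => ?_
    filter_upwards [eventually_adaptObj_le hθ] with ρ ⟨l, hl, h⟩
    exact (iInf₂_le l hl).trans (h _ (isThresholdRule_softThresh hl))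
  have hH : limsup (fun ρ : ℝ => AstarH ρ / denomLog ρ) rhoFilter ≤ 1 := by
    refine limsup_div_denomLog_le_one fun θ hθ => ?_
    filter_upwards [eventually_adaptObj_le hθ] with ρ ⟨l, hl, h⟩
    exact (iInf₂_le l hl).trans (h _ (isThresholdRule_hardThresh hl))
  have hmin : ∀ ρ : ℝ, Astar ρ ≤ min (AstarS ρ) (AstarH ρ) := fun ρ =>
    le_min
      (le_iInf₂ fun l _ => iInf_le (fun δ : {f : ℝ → ℝ // Measurable f} => adaptObj ρ δ)
        ⟨softThresh l, measurable_softThresh l⟩)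
      (le_iInf₂ fun l _ => iInf_le (fun δ : {f : ℝ → ℝ // Measurable f} => adaptObj ρ δ)
        ⟨hardThresh l, measurable_hardThresh l⟩)
  refine ⟨hS, hH, hmin, le_trans (limsup_le_limsup (Eventually.of_forall fun ρ => ?_)) hS⟩
  exact ENNReal.div_le_div_right ((hmin ρ).trans (min_le_left _ _)) _
end
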